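/- For every n ≥ 8, r̃(C4, Pn) = 2n − 2: Builder can force within 2n − 2 rounds a red copy of C4 or a blue copy of Pn, and moreover for every Builder strategy there exists a Painter strategy such that after 2n − 3 rounds the red edges contain no copy of C4 and the blue edges contain no copy of Pn. -/

import Mathlib

/-!
The online size Ramsey game on `K_ℕ`: in each round Builder selects a previously
unselected edge and Painter colours it red (`true`) or blue (`false`).
-/

namespace OnlineRamsey

abbrev Edge := Sym2 ℕ
abbrev History := List (Edge × Bool)   -- `true` = red, `false` = blue
abbrev BuilderStrat := History → Edge
abbrev PainterStrat := History → Edge → Bool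

/-- The history of the game after `t` rounds, when Builder follows `B` and
Painter follows `P`. -/
def gamePlay (B : BuilderStrat) (P : PainterStrat) : ℕ → History
  | 0 => []
  | t + 1 =>
      let h := gamePlay B P t
      h ++ [(B h, P h (B h))]

def redSet (h : History) : Set Edge := {e | (e, true) ∈ h}
def blueSet (h : History) : Set Edge := {e | (e, false) ∈ h}
def chosenSet (h : History) : Set Edge := {e | ∃ c, (e, c) ∈ h}

def redGraph (h : History) : SimpleGraph ℕ := SimpleGraph.fromEdgeSet (redSet h)
def blueGraph (h : History) : SimpleGraph ℕ := SimpleGraph.fromEdgeSet (blueSet h)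

/-- `H` contains a copy of `G`. -/
def HasCopy {α β : Type} (G : SimpleGraph α) (H : SimpleGraph β) : Prop :=
  ∃ f : G →g H, Function.Injective f

/-- During the first `m` rounds Builder always selects a previously unselected
(non-loop) edge, whatever Painter does. -/
def BuilderLegal (B : BuilderStrat) (m : ℕ) : Prop :=
  ∀ P : PainterStrat, ∀ t < m,
    ¬ (B (gamePlay B P t)).IsDiag ∧ B (gamePlay B P t) ∉ chosenSet (gamePlay B P t)

/-- Builder can force, within `m` rounds, the red graph to contain a copy of `G`
or the blue graph to contain a copy of `H`. -/
def BuilderForces {α β : Type} (G : SimpleGraph α) (H : SimpleGraph β) (m : ℕ) : Prop :=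
  ∃ B : BuilderStrat, BuilderLegal B m ∧
    ∀ P : PainterStrat, ∃ t ≤ m,
      HasCopy G (redGraph (gamePlay B P t)) ∨ HasCopy H (blueGraph (gamePlay B P t))

/-! ### The game predicate -/

def Tgt (n : ℕ) (h : History) : Prop :=
  HasCopy (SimpleGraph.cycleGraph 4) (redGraph h) ∨ HasCopy (SimpleGraph.pathGraph n) (blueGraph h)

def W (n : ℕ) : ℕ → History → Prop
  | 0, h => Tgt n h
  | m + 1, h => Tgt n h ∨ ∃ e : Edge, ¬ e.IsDiag ∧ e ∉ chosenSet h ∧ ∀ c, W n m (h ++ [(e, c)])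

theorem W_of_tgt {n m : ℕ} {h : History} (ht : Tgt n h) : W n m h := by
  cases m with
  | zero => exact ht
  | succ m => exact Or.inl ht

theorem W_succ {n : ℕ} : ∀ {m : ℕ} {h : History}, W n m h → W n (m + 1) h
  | 0, _, hw => Or.inl hw
  | m + 1, h, hw => by
    rcases hw with hw | ⟨e, h1, h2, h3⟩
    · exact Or.inl hw
    · exact Or.inr ⟨e, h1, h2, fun c => W_succ (h3 c)⟩

theorem W_mono {n m m' : ℕ} {h : History} (hm : m ≤ m') (hw : W n m h) : W n m' h := by
  induction m', hm using Nat.le_induction with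
  | base => exact hw
  | succ k _ ih => exact W_succ ih

theorem W_move {n m : ℕ} {h : History} {u v : ℕ} (huv : u ≠ v)
    (hr : ∀ h', h ⊆ h' → s(u, v) ∈ redSet h' → W n m h')
    (hb : ∀ h', h ⊆ h' → s(u, v) ∈ blueSet h' → W n m h') : W n (m + 1) h := by
  by_cases hc : s(u, v) ∈ chosenSet h
  · obtain ⟨c, hc⟩ := hc
    cases c with
    | true => exact W_succ (hr h (List.Subset.refl _) hc)
    | false => exact W_succ (hb h (List.Subset.refl _) hc)
  · refine Or.inr ⟨s(u, v), by simpa using huv, hc, fun c => ?_⟩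
    cases c with
    | true => exact hr _ (List.subset_append_left _ _) (by simp [redSet])
    | false => exact hb _ (List.subset_append_left _ _) (by simp [blueSet])

theorem exists_fresh (h : History) : ∃ e : Edge, ¬ e.IsDiag ∧ e ∉ chosenSet h := by
  have hf : (chosenSet h).Finite := by
    refine (List.finite_toSet (h.map Prod.fst)).subset ?_
    rintro e ⟨c, hc⟩
    exact List.mem_map.2 ⟨_, hc, rfl⟩
  have hi : (Set.range fun k : ℕ => s(0, k + 1)).Infinite := by
    refine Set.infinite_range_of_injective ?_
    intro a b hab
    simpa using hab
  obtain ⟨e, ⟨k, rfl⟩, he⟩ := hi.exists_notMem_finite hf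
  exact ⟨_, by simp, he⟩

theorem gamePlay_length (B : BuilderStrat) (P : PainterStrat) (t : ℕ) :
    (gamePlay B P t).length = t := by
  induction t with
  | zero => rfl
  | succ t ih => simp [gamePlay, ih]

open Classical in
theorem builderForces_of_W {n M : ℕ} (hw : W n M []) :
    BuilderForces (SimpleGraph.cycleGraph 4) (SimpleGraph.pathGraph n) M := by
  let G : History → Edge → Prop := fun h e =>
    ¬ e.IsDiag ∧ e ∉ chosenSet h ∧ ∀ c, W n (M - h.length - 1) (h ++ [(e, c)])
  let B : BuilderStrat := fun h =>
    if hx : ∃ e, G h e then Classical.choose hx else Classical.choose (exists_fresh h)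
  have hB : ∀ h, ¬ (B h).IsDiag ∧ B h ∉ chosenSet h := by
    intro h
    by_cases hx : ∃ e, G h e
    · have := Classical.choose_spec hx
      simp only [B, dif_pos hx]
      exact ⟨this.1, this.2.1⟩
    · simp only [B, dif_neg hx]
      exact Classical.choose_spec (exists_fresh h)
  refine ⟨B, fun P t _ => hB _, fun P => ?_⟩
  have key : ∀ t ≤ M, (∃ t' ≤ t, Tgt n (gamePlay B P t')) ∨ W n (M - t) (gamePlay B P t) := by
    intro t
    induction t with
    | zero => intro _; exact Or.inr hw
    | succ t ih =>
      intro ht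
      rcases ih (by omega) with ⟨t', h1, h2⟩ | h1
      · exact Or.inl ⟨t', by omega, h2⟩
      · obtain ⟨k, hk⟩ : ∃ k, M - t = k + 1 := ⟨M - t - 1, by omega⟩
        rw [hk] at h1
        rcases h1 with h1 | h1
        · exact Or.inl ⟨t, by omega, h1⟩
        · right
          have hx : ∃ e, G (gamePlay B P t) e := by
            obtain ⟨e, he⟩ := h1
            refine ⟨e, ?_⟩
            simp only [G, gamePlay_length]
            rw [hk]; exact he
          have := Classical.choose_spec hx
          have h3 := this.2.2 (P (gamePlay B P t) (B (gamePlay B P t)))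
          have hBe : B (gamePlay B P t) = Classical.choose hx := by simp only [B, dif_pos hx]
          simp only [gamePlay_length] at h3
          simp only [gamePlay]
          rw [← hBe] at h3
          rw [show M - (t + 1) = M - t - 1 by omega]
          exact h3
  rcases key M le_rfl with ⟨t, h1, h2⟩ | h1
  · exact ⟨t, h1, h2⟩
  · rw [Nat.sub_self] at h1
    exact ⟨M, le_rfl, h1⟩
/-! ### Certificates for a strategy of Builder

A position is described by finitely many labelled vertices.  The labels `< on` lie on the
heavy blue path (labels `0` and `1` are its ends), all other labels lie off it. -/

structure Leaf where
  /-- `none`: the blue path is long enough; `some j`: continue with family `j`. -/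
  tgt : Option ℕ
  lft : List ℕ
  rgt : List ℕ
  rev : Bool
  mp : List ℕ

structure Case where
  lo : ℕ
  hi : ℕ
  u : ℕ
  v : ℕ
  red : Leaf
  blue : Leaf

structure Fam where
  c : ℤ
  on : ℕ
  R : List (ℕ × ℕ)
  B : List (ℕ × ℕ)
  cases : List Case

def memE (l : List (ℕ × ℕ)) (a b : ℕ) : Bool :=
  l.any fun p => (Nat.beq p.1 a && Nat.beq p.2 b) || (Nat.beq p.1 b && Nat.beq p.2 a)

def memN (l : List ℕ) (a : ℕ) : Bool := l.any fun x => Nat.beq x a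

def nodupN : List ℕ → Bool
  | [] => true
  | a :: l => !memN l a && nodupN l

/-- the edge `a b` would close a red four-cycle `a x y b`. -/
def forcedVia (R : List (ℕ × ℕ)) (a b x y : ℕ) : Bool :=
  memE R a x && (memE R y b && (!Nat.beq a y && (!Nat.beq x b && (!Nat.beq a b &&
    (!Nat.beq a x && (!Nat.beq x y && !Nat.beq y b))))))

def forced (R : List (ℕ × ℕ)) (a b : ℕ) : Bool :=
  R.any fun p => forcedVia R a b p.1 p.2 || forcedVia R a b p.2 p.1

/-- cost (number of forced edges) of the path `x :: l`. -/
def chainCost (R B : List (ℕ × ℕ)) : ℕ → List ℕ → Option ℕ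
  | _, [] => some 0
  | x, y :: l =>
    match chainCost R B y l with
    | none => none
    | some k => if memE B x y then some k else if forced R x y then some (k + 1) else none

def lastD : ℕ → List ℕ → ℕ
  | x, [] => x
  | _, y :: l => lastD y l

def mu (mp : List ℕ) (i : ℕ) : ℕ := mp.getD i (i + 50)

def covers (f : Fam) (d : ℕ) : Bool :=
  f.cases.any fun k => Nat.ble k.lo d && Nat.ble d k.hi

/-- total forced cost of a leaf. -/
def leafCost (on : ℕ) (R B : List (ℕ × ℕ)) (l : Leaf) : Option ℕ :=
  if Nat.beq on 0 then
    match l.lft, l.rgt with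
    | [], [] => some 0
    | [], x :: r => chainCost R B x r
    | _ :: _, _ => none
  else
    match chainCost R B 0 l.lft, chainCost R B 1 l.rgt with
    | some a, some b => some (a + b)
    | _, _ => none

def endL (on : ℕ) (l : Leaf) : ℕ :=
  if Nat.beq on 0 then l.rgt.headD 0 else lastD 0 l.lft

def endR (on : ℕ) (l : Leaf) : ℕ :=
  if Nat.beq on 0 then lastD 0 l.rgt else lastD 1 l.rgt

def onPath (on : ℕ) (l : Leaf) (i : ℕ) : Bool :=
  Nat.blt i on || (memN l.lft i || memN l.rgt i)

def famOk (on : ℕ) (R B : List (ℕ × ℕ)) (c : ℤ) (lo hi : ℕ) (l : Leaf) (k : ℕ) (g : Fam) : Bool :=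
  let wid := l.lft.length + l.rgt.length
  nodupN l.mp && (l.mp.all fun x => Nat.blt x 50) &&
  (g.R.all fun p => memE R (mu l.mp p.1) (mu l.mp p.2)) &&
  (g.B.all fun p => memE B (mu l.mp p.1) (mu l.mp p.2)) &&
  Nat.ble g.on l.mp.length &&
  ((List.range l.mp.length).all fun i => Nat.blt i g.on == onPath on l (mu l.mp i)) &&
  (if Nat.beq g.on 0 then Nat.beq on 0 && Nat.beq wid 0
    else Nat.ble 2 g.on && Nat.ble 2 (on + wid) &&
      Nat.beq (mu l.mp 0) (if l.rev then endR on l else endL on l) &&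
      Nat.beq (mu l.mp 1) (if l.rev then endL on l else endR on l)) &&
  decide (g.c ≤ c - 1 - k + 2 * wid) &&
  Nat.ble wid lo &&
  ((List.range 25).all fun e =>
    !(Nat.ble lo (e + wid) && (Nat.beq hi 24 || Nat.ble (e + wid) hi)) ||
      ((Nat.beq e 0 && !Nat.beq g.on 0) || covers g e))

def leafOk (fs : List Fam) (on : ℕ) (R B : List (ℕ × ℕ)) (c : ℤ) (lo hi : ℕ) (l : Leaf) : Bool :=
  match leafCost on R B l with
  | none => false
  | some k =>
    nodupN (l.lft ++ l.rgt) && ((l.lft ++ l.rgt).all fun x => Nat.ble on x && Nat.blt x 50) &&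
    decide (0 ≤ 2 * (lo : ℤ) + c - 1 - k) &&
    (match l.tgt with
     | none => Nat.blt hi 24 && Nat.ble hi (l.lft.length + l.rgt.length)
     | some j =>
       match fs[j]? with
       | none => false
       | some g => famOk on R B c lo hi l k g)

def caseOk (fs : List Fam) (f : Fam) (k : Case) : Bool :=
  !Nat.beq k.u k.v && decide (1 ≤ 2 * (k.lo : ℤ) + f.c) && Nat.ble k.hi 24 && Nat.ble f.on 50 &&
  leafOk fs f.on ((k.u, k.v) :: f.R) f.B f.c k.lo k.hi k.red &&
  leafOk fs f.on f.R ((k.u, k.v) :: f.B) f.c k.lo k.hi k.blue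

def allOk (fs : List Fam) (gs : List Fam) : Bool :=
  gs.all fun f => f.cases.all fun k => caseOk fs f k

/-! ### Soundness of certificates -/

def rb (h : History) (a b : ℕ) : Prop := s(a, b) ∈ blueSet h

theorem rb_symm {h : History} {a b : ℕ} (hab : rb h a b) : rb h b a := by
  unfold rb at *
  rwa [Sym2.eq_swap]

theorem rb_mono {h h' : History} (hh : h ⊆ h') {a b : ℕ} (hab : rb h a b) : rb h' a b := hh hab

theorem chain_mono {h h' : History} (hh : h ⊆ h') {P : List ℕ} (hc : P.IsChain (rb h)) :
    P.IsChain (rb h') := hc.imp fun _ _ => rb_mono hh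

structure Facts (R B : List (ℕ × ℕ)) (σ : ℕ → ℕ) (h : History) : Prop where
  inj : Function.Injective σ
  red : ∀ p ∈ R, s(σ p.1, σ p.2) ∈ redSet h
  blue : ∀ p ∈ B, s(σ p.1, σ p.2) ∈ blueSet h

theorem Facts.mono {R B σ h h'} (hf : Facts R B σ h) (hh : h ⊆ h') : Facts R B σ h' :=
  ⟨hf.inj, fun p hp => hh (hf.red p hp), fun p hp => hh (hf.blue p hp)⟩

theorem memE_iff {l : List (ℕ × ℕ)} {a b : ℕ} : memE l a b = true ↔ (a, b) ∈ l ∨ (b, a) ∈ l := by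
  simp only [memE, List.any_eq_true, Bool.or_eq_true, Bool.and_eq_true, Nat.beq_eq]
  constructor
  · rintro ⟨⟨p, q⟩, hp, ⟨h1, h2⟩ | ⟨h1, h2⟩⟩
    · simp only at h1 h2; subst h1 h2; exact Or.inl hp
    · simp only at h1 h2; subst h1 h2; exact Or.inr hp
  · rintro (h | h)
    · exact ⟨_, h, Or.inl ⟨rfl, rfl⟩⟩
    · exact ⟨_, h, Or.inr ⟨rfl, rfl⟩⟩

theorem Facts.redE {R B σ h} (hf : Facts R B σ h) {a b : ℕ} (hm : memE R a b = true) :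
    s(σ a, σ b) ∈ redSet h := by
  rcases memE_iff.1 hm with h1 | h1
  · exact hf.red _ h1
  · rw [Sym2.eq_swap]; exact hf.red _ h1

theorem Facts.blueE {R B σ h} (hf : Facts R B σ h) {a b : ℕ} (hm : memE B a b = true) :
    rb h (σ a) (σ b) := by
  rcases memE_iff.1 hm with h1 | h1
  · exact hf.blue _ h1
  · exact rb_symm (hf.blue _ h1)

theorem memN_iff {l : List ℕ} {a : ℕ} : memN l a = true ↔ a ∈ l := by
  simp [memN]

theorem nodupN_iff {l : List ℕ} : nodupN l = true ↔ l.Nodup := by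
  induction l with
  | nil => simp [nodupN]
  | cons a l ih => simp [nodupN, ih, ← memN_iff]

theorem tgt_c4 {n : ℕ} {h : History} {a x y b : ℕ} (h1 : s(a, x) ∈ redSet h) (h2 : s(x, y) ∈ redSet h)
    (h3 : s(y, b) ∈ redSet h) (h4 : s(a, b) ∈ redSet h) (hay : a ≠ y) (hxb : x ≠ b) (hab : a ≠ b)
    (hax : a ≠ x) (hxy : x ≠ y) (hyb : y ≠ b) : Tgt n h := by
  left
  have r : ∀ {p q : ℕ}, s(p, q) ∈ redSet h → p ≠ q → (redGraph h).Adj p q := by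
    intro p q hp hq
    simp [redGraph, hp, hq]
  refine ⟨⟨![a, x, y, b], ?_⟩, ?_⟩
  · intro i j hij
    fin_cases i <;> fin_cases j <;>
      first
      | exact absurd hij (by decide)
      | exact r h1 hax
      | exact (r h1 hax).symm
      | exact r h2 hxy
      | exact (r h2 hxy).symm
      | exact r h3 hyb
      | exact (r h3 hyb).symm
      | exact r h4 hab
      | exact (r h4 hab).symm
  · intro i j hij
    have e1 := hay.symm
    have e2 := hxb.symm
    have e3 := hab.symm
    have e4 := hax.symm
    have e5 := hxy.symm
    have e6 := hyb.symm
    fin_cases i <;> fin_cases j <;> first | rfl | (exfalso; simp at hij; contradiction)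

theorem tgt_path {n : ℕ} {h : History} {P : List ℕ} (hn : P.Nodup) (hc : P.IsChain (rb h))
    (hl : n ≤ P.length) : Tgt n h := by
  right
  have key : ∀ i j : Fin n, i.1 + 1 = j.1 →
      (blueGraph h).Adj (P[i.1]'(by omega)) (P[j.1]'(by omega)) := by
    intro i j hij
    have hj := j.2
    have := List.isChain_iff_getElem.1 hc i.1 (by omega)
    simp only [blueGraph, SimpleGraph.fromEdgeSet_adj]
    refine ⟨?_, ?_⟩
    · simp only [← hij]; exact this
    · intro he
      have := (hn.getElem_inj_iff).1 he
      omega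
  refine ⟨⟨fun i => P[i.1]'(by omega), ?_⟩, ?_⟩
  · intro i j hij
    rw [SimpleGraph.pathGraph_adj] at hij
    rcases hij with hij | hij
    · exact key i j hij
    · exact (key j i hij).symm
  · intro i j hij
    have := (hn.getElem_inj_iff).1 hij
    exact Fin.ext this

theorem forced_step {n m : ℕ} {R B σ h} (hf : Facts R B σ h) {a b : ℕ} (hF : forced R a b = true)
    (hk : ∀ h', h ⊆ h' → rb h' (σ a) (σ b) → W n m h') : W n (m + 1) h := by
  have main : ∀ x y, memE R x y = true → forcedVia R a b x y = true → W n (m + 1) h := by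
    intro x y hxy hv
    simp only [forcedVia, Bool.and_eq_true, Bool.not_eq_true', ← Bool.not_eq_true, Nat.beq_eq] at hv
    obtain ⟨h1, h2, h3, h4, h5, h6, h7, h8⟩ := hv
    have ne : ∀ {p q : ℕ}, ¬ p = q → σ p ≠ σ q := fun hpq he => hpq (hf.inj he)
    refine W_move (ne h5) (fun h' hh hr => W_of_tgt ?_) hk
    have hf' := hf.mono hh
    exact tgt_c4 (hf'.redE h1) (hf'.redE hxy) (hf'.redE h2) hr (ne h3) (ne h4) (ne h5) (ne h6) (ne h7)
      (ne h8)
  simp only [forced, List.any_eq_true, Bool.or_eq_true] at hF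
  obtain ⟨⟨p, q⟩, hp, hF | hF⟩ := hF
  · exact main p q (memE_iff.2 (Or.inl hp)) hF
  · exact main q p (memE_iff.2 (Or.inr hp)) hF

theorem chain_force {n : ℕ} {R B σ} : ∀ (l : List ℕ) (x m k : ℕ) (h : History), Facts R B σ h →
    chainCost R B x l = some k → k ≤ m →
    (∀ h', h ⊆ h' → ((x :: l).map σ).IsChain (rb h') → W n (m - k) h') → W n m h
  | [], x, m, k, h, hf, hc, hk, hW => by
    simp only [chainCost, Option.some.injEq] at hc
    subst hc
    exact hW h (List.Subset.refl _) (by simp)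
  | y :: l, x, m, k, h, hf, hc, hk, hW => by
    rw [chainCost] at hc
    cases hc1 : chainCost R B y l with
    | none => simp [hc1] at hc
    | some k' =>
      simp only [hc1] at hc
      by_cases hb : memE B x y = true
      · simp only [hb, if_true, Option.some.injEq] at hc
        subst hc
        refine chain_force l y m k' h hf hc1 hk fun h' hh hch => hW h' hh ?_
        simp only [List.map_cons] at hch ⊢
        exact List.IsChain.cons_cons ((hf.mono hh).blueE hb) hch
      · simp only [hb] at hc
        by_cases hF : forced R x y = true
        · simp only [hF, if_true] at hc
          have hc' : k' + 1 = k := by simpa using hc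
          subst hc'
          refine chain_force l y m k' h hf hc1 (by omega) fun h' hh hch => ?_
          rw [show m - k' = (m - (k' + 1)) + 1 by omega]
          refine forced_step (hf.mono hh) hF fun h'' hh' hb' => hW h'' (List.Subset.trans hh hh') ?_
          simp only [List.map_cons] at hch ⊢
          exact List.IsChain.cons_cons hb' (chain_mono hh' hch)
        · simp [hF] at hc

structure HP (h : History) (P : List ℕ) (x y : ℕ) : Prop where
  nodup : P.Nodup
  chain : P.IsChain (rb h)
  head : P.head? = some x
  last : P.getLast? = some y

theorem HP.reverse {h P x y} (hp : HP h P x y) : HP h P.reverse y x := by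
  refine ⟨List.nodup_reverse.2 hp.nodup, ?_, by simpa using hp.last, by simpa using hp.head⟩
  rw [List.isChain_reverse]
  exact hp.chain.imp fun _ _ => rb_symm

theorem map_getLast_lastD (σ : ℕ → ℕ) : ∀ (l : List ℕ) (x : ℕ),
    ((x :: l).map σ).getLast? = some (σ (lastD x l))
  | [], x => by simp [lastD]
  | y :: l, x => by
    have := map_getLast_lastD σ l y
    simp only [List.map_cons] at this ⊢
    rw [List.getLast?_cons_cons, this, lastD]

theorem HP.extend {h P x y} {σ : ℕ → ℕ} (hp : HP h P x (σ y)) {l : List ℕ}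
    (hl : ((y :: l).map σ).IsChain (rb h)) (hn : (P ++ l.map σ).Nodup) :
    HP h (P ++ l.map σ) x (σ (lastD y l)) := by
  have hP : P ≠ [] := by
    rintro rfl
    simpa using hp.head
  refine ⟨hn, ?_, ?_, ?_⟩
  · rw [List.isChain_append]
    refine ⟨hp.chain, ?_, ?_⟩
    · rw [List.map_cons] at hl
      exact hl.tail
    · intro a ha b hb
      rw [hp.last] at ha
      simp only [Option.mem_def, Option.some.injEq] at ha
      subst ha
      cases l with
      | nil => simp at hb
      | cons z l =>
        simp at hb
        subst hb
        simp only [List.map_cons] at hl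
        exact hl.rel
  · rw [List.head?_append_of_ne_nil _ hP]
    exact hp.head
  · cases l with
    | nil => simpa [lastD] using hp.last
    | cons z l =>
      rw [List.getLast?_append_of_ne_nil _ (by simp), map_getLast_lastD, lastD]

structure PathOk (on : ℕ) (σ : ℕ → ℕ) (h : History) (P : List ℕ) : Prop where
  nodup : P.Nodup
  chain : P.IsChain (rb h)
  mem : ∀ i, σ i ∈ P ↔ i < on
  ends : (on = 0 ∧ P = []) ∨ (0 < on ∧ P.head? = some (σ 0) ∧ P.getLast? = some (σ 1))

/-- what we know after the forced moves of a leaf -/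
structure NewPath (on : ℕ) (l : Leaf) (σ : ℕ → ℕ) (h : History) (P P' : List ℕ) : Prop where
  nodup : P'.Nodup
  chain : P'.IsChain (rb h)
  len : P'.length = P.length + (l.lft.length + l.rgt.length)
  mem : ∀ i, σ i ∈ P' ↔ onPath on l i = true
  ends : 0 < on + (l.lft.length + l.rgt.length) →
    P'.head? = some (σ (endL on l)) ∧ P'.getLast? = some (σ (endR on l))

theorem leaf_force {n m k on : ℕ} {R B σ h} {P : List ℕ} {l : Leaf} (hf : Facts R B σ h)
    (hP : PathOk on σ h P) (hc : leafCost on R B l = some k) (hnd : (l.lft ++ l.rgt).Nodup)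
    (hge : ∀ x ∈ l.lft ++ l.rgt, on ≤ x) (hk : k ≤ m)
    (hW : ∀ h', h ⊆ h' → ∀ P', NewPath on l σ h' P P' → W n (m - k) h') : W n m h := by
  rcases l with ⟨tgt, L, Rr, rev, mp⟩
  simp only at hnd hge
  rcases hP.ends with ⟨h0, hPn⟩ | ⟨hpos, hhead, hlast⟩
  · subst h0 hPn
    simp only [leafCost, Nat.beq_refl, if_true] at hc
    cases L with
    | cons a L => simp at hc
    | nil =>
      cases Rr with
      | nil =>
        simp only [Option.some.injEq] at hc
        subst hc
        refine hW h (List.Subset.refl _) [] ⟨by simp, by simp, by simp, ?_, ?_⟩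
        · intro i; simp [onPath, memN, Nat.blt]
        · intro hx; simp at hx
      | cons x r =>
        simp only at hc
        refine chain_force r x m k h hf hc hk fun h' hh hch => ?_
        refine hW h' hh ((x :: r).map σ) ⟨?_, hch, by simp, ?_, ?_⟩
        · exact (List.nodup_map_iff hf.inj).2 (by simpa using hnd)
        · intro i
          rw [List.mem_map_of_injective hf.inj]
          have hix : i = x ↔ x = i := eq_comm
          simp [onPath, Nat.blt, memN]
          tauto
        · intro _
          refine ⟨by simp [endL], ?_⟩
          rw [map_getLast_lastD]
          simp [endR, lastD]
  · have hne : Nat.beq on 0 = false := by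
      rw [← Bool.not_eq_true, Nat.beq_eq]; omega
    simp only [leafCost, hne] at hc
    cases hc1 : chainCost R B 0 L with
    | none => simp [hc1] at hc
    | some a =>
      cases hc2 : chainCost R B 1 Rr with
      | none => simp [hc1, hc2] at hc
      | some b =>
        simp [hc1, hc2] at hc
        subst hc
        refine chain_force L 0 m a h hf hc1 (by omega) fun h1 hh1 hch1 => ?_
        refine chain_force Rr 1 (m - a) b h1 (hf.mono hh1) hc2 (by omega) fun h2 hh2 hch2 => ?_
        have hh := List.Subset.trans hh1 hh2
        have base : HP h2 P (σ 0) (σ 1) := ⟨hP.nodup, chain_mono hh hP.chain, hhead, hlast⟩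
        have disj : ∀ x ∈ L ++ Rr, σ x ∉ P := by
          intro x hx hxP
          have := (hP.mem x).1 hxP
          have := hge x hx
          omega
        have ndL : (L.map σ).Nodup := (List.nodup_map_iff hf.inj).2 (List.nodup_append.1 hnd).1
        have ndR : (Rr.map σ).Nodup := (List.nodup_map_iff hf.inj).2 (List.nodup_append.1 hnd).2.1
        have n1 : (P ++ Rr.map σ).Nodup := by
          rw [List.nodup_append]
          refine ⟨hP.nodup, ndR, ?_⟩
          rintro a ha _ hb rfl
          obtain ⟨c, hc, rfl⟩ := List.mem_map.1 hb
          exact disj c (by simp [hc]) ha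
        have s1 := (base.extend hch2 n1).reverse
        have n2 : ((P ++ Rr.map σ).reverse ++ L.map σ).Nodup := by
          rw [List.nodup_append]
          refine ⟨List.nodup_reverse.2 n1, ndL, ?_⟩
          rintro a ha _ hb rfl
          obtain ⟨c, hc, rfl⟩ := List.mem_map.1 hb
          rw [List.mem_reverse, List.mem_append] at ha
          rcases ha with ha | ha
          · exact disj c (by simp [hc]) ha
          · rw [List.mem_map_of_injective hf.inj] at ha
            exact (List.nodup_append.1 hnd).2.2 c hc c ha rfl
        have s2 := (s1.extend (chain_mono hh2 hch1) n2).reverse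
        rw [show m - a - b = m - (a + b) by omega]
        refine hW h2 hh _ ⟨s2.nodup, s2.chain, ?_, ?_, ?_⟩
        · simp; omega
        · intro i
          rw [List.mem_reverse, List.mem_append, List.mem_reverse, List.mem_append,
            List.mem_map_of_injective hf.inj, List.mem_map_of_injective hf.inj, hP.mem]
          simp [onPath, memN_iff]
          tauto
        · intro _
          simp only [endL, endR, hne]
          exact ⟨s2.head, s2.last⟩

theorem mu_of_lt {mp : List ℕ} {i : ℕ} (hi : i < mp.length) : mu mp i = mp[i] := by
  simp [mu, hi]

theorem mu_of_ge {mp : List ℕ} {i : ℕ} (hi : mp.length ≤ i) : mu mp i = i + 50 := by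
  simp [mu, hi]

theorem mu_inj {mp : List ℕ} (hn : mp.Nodup) (hlt : ∀ x ∈ mp, x < 50) : Function.Injective (mu mp) := by
  intro i j hij
  rcases lt_or_ge i mp.length with hi | hi <;> rcases lt_or_ge j mp.length with hj | hj
  · rw [mu_of_lt hi, mu_of_lt hj] at hij
    exact hn.getElem_inj_iff.1 hij
  · rw [mu_of_lt hi, mu_of_ge hj] at hij
    have := hlt _ (List.getElem_mem hi)
    omega
  · rw [mu_of_ge hi, mu_of_lt hj] at hij
    have := hlt _ (List.getElem_mem hj)
    omega
  · rw [mu_of_ge hi, mu_of_ge hj] at hij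
    omega

/-- The family `f` is won with `m` rounds left and `d` missing path vertices. -/
def FamWin (n m : ℕ) (f : Fam) : Prop :=
  ∀ d h σ P, (covers f (min d 24) = true ∨ (d = 0 ∧ 0 < f.on)) → 2 * (d : ℤ) + f.c ≤ m →
    Facts f.R f.B σ h → PathOk f.on σ h P → P.length + d = n → W n m h

theorem fam_leaf {n m k on d lo hi : ℕ} {c : ℤ} {R B σ h} {P P' : List ℕ} {l : Leaf} {g : Fam}
    (hf : Facts R B σ h) (hon : on ≤ 50) (hlt : ∀ x ∈ l.lft ++ l.rgt, x < 50)
    (hok : famOk on R B c lo hi l k g = true) (hN : NewPath on l σ h P P')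
    (hlen : P.length + d = n) (hlo : lo ≤ min d 24) (hhi : min d 24 ≤ hi) (hhi' : hi ≤ 24)
    (hP0 : on = 0 → P = [])
    (hm : 2 * (d : ℤ) + c - 1 - k ≤ m) (hg : FamWin n m g) : W n m h := by
  simp only [famOk, Bool.and_eq_true, List.all_eq_true, decide_eq_true_eq, List.mem_range,
    nodupN_iff, Nat.ble_eq] at hok
  obtain ⟨⟨⟨⟨⟨⟨⟨⟨⟨h1, h2⟩, h3⟩, h4⟩, h5⟩, h6⟩, h7⟩, h8⟩, h9⟩, h10⟩ := hok
  set wid := l.lft.length + l.rgt.length with hadd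
  have h2' : ∀ x ∈ l.mp, x < 50 := fun x hx => by simpa [Nat.blt] using h2 x hx
  have hinj : Function.Injective (σ ∘ mu l.mp) := hf.inj.comp (mu_inj h1 h2')
  have hF : Facts g.R g.B (σ ∘ mu l.mp) h :=
    ⟨hinj, fun p hp => hf.redE (h3 p hp), fun p hp => hf.blueE (h4 p hp)⟩
  have hmem : ∀ i, onPath on l (mu l.mp i) = true ↔ i < g.on := by
    intro i
    rcases lt_or_ge i l.mp.length with hi | hi
    · have := h6 i hi
      rw [beq_iff_eq] at this
      rw [← this]
      simp [Nat.blt]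
    · rw [mu_of_ge hi]
      simp only [onPath, Bool.or_eq_true, memN_iff]
      constructor
      · rintro (hx | hx | hx)
        · simp [Nat.blt] at hx; omega
        · have := hlt _ (List.mem_append_left _ hx); omega
        · have := hlt _ (List.mem_append_right _ hx); omega
      · intro hx; omega
  have hcov : covers g (min (d - wid) 24) = true ∨ (d - wid = 0 ∧ 0 < g.on) := by
    have := h10 (min (d - wid) 24) (by omega)
    simp only [Bool.or_eq_true, Bool.not_eq_true', ← Bool.not_eq_true, Bool.and_eq_true, Nat.ble_eq,
      Nat.beq_eq] at this
    rcases this with hx | ⟨hx, hy⟩ | hx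
    · exfalso
      apply hx
      omega
    · right; omega
    · exact Or.inl hx
  have hlen' : P'.length + (d - wid) = n := by
    rw [hN.len]; omega
  have hm' : 2 * ((d - wid : ℕ) : ℤ) + g.c ≤ m := by
    have : ((d - wid : ℕ) : ℤ) = d - wid := by
      rw [Nat.cast_sub (by omega)]
    rw [this]
    omega
  by_cases hg0 : g.on = 0
  · simp only [hg0, Nat.beq_refl, if_true, Bool.and_eq_true, Nat.beq_eq] at h7
    have hP'0 : P' = [] := by
      have := hN.len
      rw [hP0 h7.1, ← hadd, h7.2] at this
      simpa using this
    refine hg (d - wid) h _ P' hcov hm' hF ⟨hN.nodup, hN.chain, ?_, Or.inl ⟨hg0, hP'0⟩⟩ hlen'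
    intro i
    rw [Function.comp, hN.mem, hmem]
  · have hb : Nat.beq g.on 0 = false := by
      rw [← Bool.not_eq_true, Nat.beq_eq]; exact hg0
    simp only [hb, Bool.and_eq_true, Nat.ble_eq, Nat.beq_eq, Bool.false_eq_true, if_false] at h7
    obtain ⟨⟨⟨ha, hb2⟩, hc⟩, hd⟩ := h7
    obtain ⟨he1, he2⟩ := hN.ends (by omega)
    cases hrev : l.rev with
    | false =>
      simp only [hrev, Bool.false_eq_true, if_false] at hc hd
      refine hg (d - wid) h _ P' hcov hm' hF ⟨hN.nodup, hN.chain, ?_, Or.inr ⟨by omega, ?_, ?_⟩⟩ hlen'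
      · intro i
        rw [Function.comp, hN.mem, hmem]
      · rw [Function.comp, hc]; exact he1
      · rw [Function.comp, hd]; exact he2
    | true =>
      simp only [hrev, if_true] at hc hd
      have hp := (HP.mk hN.nodup hN.chain he1 he2).reverse
      refine hg (d - wid) h _ P'.reverse hcov hm' hF
        ⟨hp.nodup, hp.chain, ?_, Or.inr ⟨by omega, ?_, ?_⟩⟩ (by simpa using hlen')
      · intro i
        rw [List.mem_reverse, Function.comp, hN.mem, hmem]
      · rw [Function.comp, hc]; exact hp.head
      · rw [Function.comp, hd]; exact hp.last

theorem leaf_sound {n m on d lo hi : ℕ} {c : ℤ} {R B σ h} {P : List ℕ} {l : Leaf} {fs : List Fam}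
    (hf : Facts R B σ h) (hP : PathOk on σ h P) (hon : on ≤ 50)
    (hok : leafOk fs on R B c lo hi l = true)
    (hlen : P.length + d = n) (hlo : lo ≤ min d 24) (hhi : min d 24 ≤ hi) (hhi' : hi ≤ 24)
    (hm : 2 * (d : ℤ) + c - 1 ≤ m) (hg : ∀ m' ≤ m, ∀ g ∈ fs, FamWin n m' g) : W n m h := by
  unfold leafOk at hok
  cases hk : leafCost on R B l with
  | none => simp [hk] at hok
  | some k =>
    simp only [hk, Bool.and_eq_true, List.all_eq_true, decide_eq_true_eq, nodupN_iff, Nat.ble_eq] at hok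
    obtain ⟨⟨⟨h1, h2⟩, h3⟩, h4⟩ := hok
    have hlt : ∀ x ∈ l.lft ++ l.rgt, x < 50 := fun x hx => by simpa [Nat.blt] using (h2 x hx).2
    have hkm : k ≤ m := by omega
    refine leaf_force hf hP hk h1 (fun x hx => (h2 x hx).1) hkm fun h' hh P' hN => ?_
    cases ht : l.tgt with
    | none =>
      simp only [ht, Bool.and_eq_true, Nat.ble_eq] at h4
      obtain ⟨h5, h6⟩ := h4
      have h5' : hi < 24 := by simpa [Nat.blt] using h5
      refine W_of_tgt (tgt_path hN.nodup hN.chain ?_)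
      rw [hN.len]
      omega
    | some j =>
      simp only [ht] at h4
      cases hj : fs[j]? with
      | none => simp [hj] at h4
      | some g =>
        simp only [hj] at h4
        refine fam_leaf (hf.mono hh) hon hlt h4 hN hlen hlo hhi hhi' ?_ ?_
          (hg (m - k) (by omega) g (List.mem_of_getElem? hj))
        · intro h0
          rcases hP.ends with hx | hx
          · exact hx.2
          · omega
        · rw [Nat.cast_sub hkm]
          omega

theorem fams_sound {n : ℕ} {fs : List Fam} (hok : allOk fs fs = true) :
    ∀ m, ∀ f ∈ fs, FamWin n m f := by
  intro m
  induction m using Nat.strong_induction_on with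
  | _ m ih =>
    intro f hf d h σ P hcov hm hF hP hlen
    rcases hcov with hcov | ⟨hd, hon⟩
    · simp only [covers, List.any_eq_true, Bool.and_eq_true, Nat.ble_eq] at hcov
      obtain ⟨k, hk, hlo, hhi⟩ := hcov
      simp only [allOk, List.all_eq_true] at hok
      have hc := hok f hf k hk
      simp only [caseOk, Bool.and_eq_true, decide_eq_true_eq, Nat.ble_eq, Bool.not_eq_true',
        ← Bool.not_eq_true, Nat.beq_eq] at hc
      obtain ⟨⟨⟨⟨⟨h1, h2⟩, h3⟩, h4⟩, h5⟩, h6⟩ := hc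
      obtain ⟨m', rfl⟩ : ∃ m', m = m' + 1 := ⟨m - 1, by omega⟩
      have hrec : ∀ m'' ≤ m', ∀ g ∈ fs, FamWin n m'' g := fun m'' hm'' => ih m'' (by omega)
      have hm2 : 2 * (d : ℤ) + f.c - 1 ≤ m' := by push_cast at hm; omega
      refine W_move (fun he => h1 (hF.inj he)) (u := σ k.u) (v := σ k.v) ?_ ?_
      · intro h' hh hr
        have hF' := hF.mono hh
        have hP' : PathOk f.on σ h' P := ⟨hP.nodup, chain_mono hh hP.chain, hP.mem, hP.ends⟩
        refine leaf_sound ⟨hF'.inj, ?_, hF'.blue⟩ hP' h4 h5 hlen hlo hhi h3 hm2 hrec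
        intro p hp
        rcases List.mem_cons.1 hp with rfl | hp
        · exact hr
        · exact hF'.red p hp
      · intro h' hh hr
        have hF' := hF.mono hh
        have hP' : PathOk f.on σ h' P := ⟨hP.nodup, chain_mono hh hP.chain, hP.mem, hP.ends⟩
        refine leaf_sound ⟨hF'.inj, hF'.red, ?_⟩ hP' h4 h6 hlen hlo hhi h3 hm2 hrec
        intro p hp
        rcases List.mem_cons.1 hp with rfl | hp
        · exact hr
        · exact hF'.blue p hp
    · exact W_of_tgt (tgt_path hP.nodup hP.chain (by omega))

theorem builder_wins_of {n : ℕ} {fs : List Fam} {f : Fam} (hok : allOk fs fs = true)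
    (hf : f ∈ fs) (hR : f.R = []) (hB : f.B = []) (hon : f.on = 0) (hc : f.c = -2)
    (hcov : covers f (min n 24) = true) (hn : 8 ≤ n) : W n (2 * n - 2) [] := by
  refine fams_sound hok (2 * n - 2) f hf n [] id [] (Or.inl hcov) ?_ ⟨Function.injective_id, ?_, ?_⟩
    ⟨by simp, by simp, by simp [hon], Or.inl ⟨hon, rfl⟩⟩ (by simp)
  · rw [hc, Nat.cast_sub (by omega)]; push_cast; omega
  · simp [hR]
  · simp [hB]
/-- leaf: the blue path is complete -/
def wn (l r : List ℕ) : Leaf := ⟨none, l, r, false, []⟩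

/-- leaf: go to family `j` along `m` after extending the path -/
def go (j : ℕ) (l r m : List ℕ) : Leaf := ⟨some j, l, r, false, m⟩

/-- the same with the path reversed -/
def gr (j : ℕ) (l r m : List ℕ) : Leaf := ⟨some j, l, r, true, m⟩

/-- leaf: family `j` with the same labels -/
def st (j k : ℕ) : Leaf := ⟨some j, [], [], false, List.range k⟩

/-- the empty board -/
def startFam : Fam := ⟨-2, 0, [], [], [⟨8, 24, 0, 1, st 5 2, go 6 [] [0,1] [0,1]⟩]⟩

def fams0 : List Fam := [
  startFam,
  ⟨2, 2, [], [], [⟨1, 1, 0, 2, st 7 3, wn [2] []⟩,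
    ⟨2, 24, 0, 2, st 7 3, go 1 [2] [] [2,1]⟩]⟩,
  ⟨0, 2, [(0,2),(1,2)], [], [⟨1, 1, 0, 3, go 8 [] [3] [0,3,2], gr 7 [3] [] [1,3,2]⟩,
    ⟨2, 23, 0, 3, st 80 4, st 81 4⟩,
    ⟨24, 24, 0, 3, go 8 [] [3] [0,3,2], gr 7 [3] [] [1,3,2]⟩]⟩,
  ⟨1, 3, [(0,2),(1,2)], [], [⟨1, 1, 0, 3, go 4 [] [3] [0,3], go 1 [3] [] [3,1]⟩,
    ⟨2, 2, 0, 3, st 79 4, go 1 [3] [] [3,1]⟩,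
    ⟨3, 24, 0, 3, go 4 [] [3] [0,3], go 1 [3] [] [3,1]⟩]⟩,
  ⟨1, 2, [(0,1)], [], [⟨2, 24, 0, 2, st 8 3, go 1 [2] [] [2,1]⟩]⟩,
  ⟨-3, 0, [(0,1)], [], [⟨8, 24, 0, 2, st 9 3, go 10 [] [0,2] [0,2,1]⟩]⟩,
  ⟨1, 2, [], [], [⟨5, 24, 0, 2, st 10 3, go 1 [2] [] [2,1]⟩]⟩,
  ⟨1, 2, [(0,2)], [], [⟨1, 24, 1, 2, st 2 3, go 1 [] [2] [0,2]⟩]⟩,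
  ⟨0, 2, [(0,1),(0,2)], [], [⟨2, 2, 2, 3, go 2 [] [3] [0,3,2], st 92 4⟩,
    ⟨3, 3, 0, 3, st 90 4, st 91 4⟩,
    ⟨4, 4, 2, 3, go 2 [] [3] [0,3,2], st 92 4⟩,
    ⟨5, 24, 0, 3, st 90 4, st 91 4⟩]⟩,
  ⟨-4, 0, [(0,1),(0,2)], [], [⟨8, 24, 0, 3, st 11 4, go 12 [] [0,3] [0,3,1,2]⟩]⟩,
  ⟨0, 2, [(0,2)], [], [⟨5, 5, 2, 3, st 13 4, st 83 4⟩,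
    ⟨6, 24, 0, 3, st 12 4, go 6 [3] [] [3,1]⟩]⟩,
  ⟨-5, 0, [(0,1),(0,2),(0,3)], [], [⟨8, 8, 1, 4, st 15 5, go 17 [] [1,4] [1,4,0,2,3]⟩,
    ⟨9, 24, 1, 4, go 16 [] [2,4,3] [2,3,0,1], go 17 [] [1,4] [1,4,0,2,3]⟩]⟩,
  ⟨-1, 2, [(0,2),(0,3)], [], [⟨4, 24, 0, 4, st 14 5, st 84 5⟩]⟩,
  ⟨-1, 2, [(0,2),(2,3)], [], [⟨5, 5, 2, 4, st 17 5, st 85 5⟩]⟩,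
  ⟨-2, 2, [(0,2),(0,3),(0,4)], [], [⟨4, 4, 2, 3, st 95 5, st 96 5⟩,
    ⟨5, 24, 1, 2, st 39 5, go 90 [] [2] [0,2,3,4]⟩]⟩]

def fams1 : List Fam := [
  ⟨-6, 0, [(0,1),(0,2),(0,3),(1,4)], [], [⟨8, 8, 1, 5, st 20 6, go 21 [] [1,5] [1,5,0,2,3,4]⟩]⟩,
  ⟨-2, 2, [(0,2),(1,2),(2,3)], [], [⟨6, 6, 0, 4, st 23 5, st 24 5⟩,
    ⟨7, 24, 2, 4, st 18 5, st 19 5⟩]⟩,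
  ⟨-2, 2, [(0,2),(2,3),(2,4)], [], [⟨5, 5, 3, 5, st 25 6, st 99 6⟩,
    ⟨6, 6, 0, 5, st 21 6, st 98 6⟩,
    ⟨7, 24, 1, 3, go 16 [] [4] [0,4,2,3], st 97 5⟩]⟩,
  ⟨-3, 2, [(0,2),(1,2),(2,3),(2,4)], [], [⟨7, 7, 0, 5, st 26 6, gr 17 [5] [] [1,5,2,3,4]⟩,
    ⟨8, 24, 0, 5, go 16 [] [5,3] [0,3,2,4], gr 17 [5] [] [1,5,2,3,4]⟩]⟩,
  ⟨-3, 2, [(0,2),(1,2),(2,3)], [(2,4)], [⟨4, 24, 0, 5, go 34 [] [] [0,1,2,3,5,4], st 101 6⟩]⟩,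
  ⟨-7, 0, [(0,1),(0,2),(0,3),(1,4),(1,5)], [], [⟨8, 8, 2, 6, st 29 7, go 32 [] [2,6] [2,6,0,1,3,4,5]⟩]⟩,
  ⟨-3, 2, [(0,2),(0,5),(2,3),(2,4)], [], [⟨6, 6, 1, 3, st 22 6, go 2 [] [3,5,4] [0,4,2]⟩]⟩,
  ⟨-4, 2, [(0,2),(0,5),(1,3),(2,3),(2,4)], [], [⟨6, 6, 0, 6, st 30 7, st 36 7⟩]⟩,
  ⟨-3, 2, [(0,2),(0,4),(1,2),(2,3)], [], [⟨6, 6, 0, 5, st 31 6, st 37 6⟩]⟩,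
  ⟨-3, 2, [(0,2),(1,2),(2,3)], [(0,4)], [⟨6, 6, 2, 5, go 27 [] [] [0,1,2,3,5,4], go 101 [] [] [0,1,2,3,5,4]⟩]⟩,
  ⟨-3, 2, [(0,2),(2,3),(2,4),(3,5)], [], [⟨5, 5, 3, 4, st 132 6, st 133 6⟩]⟩,
  ⟨-4, 2, [(0,2),(0,5),(1,2),(2,3),(2,4)], [], [⟨7, 7, 1, 6, st 40 7, go 21 [] [6] [0,6,2,3,4,5]⟩]⟩,
  ⟨-4, 2, [(0,2),(1,2),(2,3),(2,4)], [(0,5)], [⟨6, 6, 3, 6, go 38 [] [] [0,1,2,3,4,6,5], go 136 [] [] [0,1,2,3,4,6,5]⟩]⟩,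
  ⟨-4, 2, [(0,3),(1,3),(2,3),(2,4)], [(2,5)], [⟨4, 4, 0, 2, wn [4,3] [2,5], st 137 6⟩]⟩,
  ⟨-8, 0, [(0,1),(0,2),(0,3),(1,4),(1,5),(2,6)], [], [⟨8, 8, 4, 7, wn [] [0,7,5,2,4,3,6,1], go 50 [] [4,7] [4,7,0,1,2,3,5,6]⟩]⟩]

def fams2 : List Fam := [
  ⟨-5, 2, [(0,2),(0,5),(0,6),(1,3),(2,3),(2,4)], [], [⟨6, 6, 5, 7, wn [] [4,5,3,6,7,2], go 49 [] [4] [0,4,2,3,5,6,7]⟩]⟩,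
  ⟨-4, 2, [(0,2),(0,4),(0,5),(1,2),(2,3)], [], [⟨5, 5, 4, 6, wn [] [4,3,5,6,2], st 49 7⟩,
    ⟨6, 6, 1, 6, st 46 7, st 47 7⟩]⟩,
  ⟨-4, 2, [(0,2),(2,3),(2,4),(3,5),(3,6)], [], [⟨6, 6, 5, 7, go 50 [] [] [0,1,3,2,5,6,4,7], st 234 8⟩]⟩,
  ⟨-5, 2, [(0,2),(0,5),(1,3),(2,3),(2,4)], [(2,6)], [⟨5, 5, 0, 6, wn [] [4,5,3,6,2], wn [6,2] [4,5,3]⟩]⟩,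
  ⟨-4, 2, [(0,2),(0,4),(1,2),(2,3)], [(2,5)], [⟨4, 4, 0, 5, wn [] [4,3,5,2], wn [5,2] [4,3]⟩,
    ⟨5, 5, 1, 3, st 135 6, st 138 6⟩,
    ⟨6, 24, 2, 6, go 19 [] [4,3] [0,3,2,6,5], st 139 7⟩]⟩,
  ⟨-2, 2, [(0,2),(1,2)], [(2,3)], [⟨5, 5, 2, 4, go 19 [] [] [0,1,2,4,3], st 86 5⟩]⟩,
  ⟨-5, 2, [(0,2),(0,5),(1,3),(2,3),(2,4)], [(0,6)], [⟨6, 6, 5, 6, st 236 7, go 2 [6,5,3] [4] [3,4,2]⟩]⟩,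
  ⟨-4, 2, [(0,2),(0,4),(1,2),(2,3)], [(0,5)], [⟨4, 4, 4, 5, wn [5,2] [4,3], go 2 [5,4,3] [] [3,1,2]⟩,
    ⟨5, 6, 4, 5, st 141 6, go 2 [5,4,3] [] [3,1,2]⟩,
    ⟨7, 7, 3, 6, go 45 [] [] [0,1,2,3,6,4,5], st 142 7⟩]⟩,
  ⟨-5, 2, [(0,2),(1,2),(2,3),(2,4),(3,5)], [(0,6)], [⟨6, 6, 3, 7, go 51 [] [] [0,1,2,3,4,5,7,6], go 238 [] [] [0,1,2,3,4,5,7,6]⟩]⟩,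
  ⟨-3, 2, [(0,2),(0,3),(0,4),(1,2)], [], [⟨5, 5, 2, 5, go 31 [] [] [0,1,2,5,3,4], st 60 6⟩,
    ⟨6, 24, 3, 5, st 58 6, go 12 [] [3,5] [0,5,2,4]⟩]⟩,
  ⟨-5, 2, [(0,2),(0,5),(1,2),(1,6),(2,3),(2,4)], [], [⟨7, 7, 0, 7, go 55 [] [] [0,1,2,3,4,5,7,6], st 64 8⟩]⟩,
  ⟨-5, 2, [(0,2),(0,5),(1,2),(2,3),(2,4)], [(1,6)], [⟨6, 6, 5, 6, st 240 7, st 241 7⟩]⟩,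
  ⟨-5, 2, [(0,2),(0,3),(0,4),(2,5),(2,6),(3,7)], [], [⟨6, 6, 1, 5, wn [] [6,3,5,4,7,2], wn [] [5,3,6,4,7,2]⟩]⟩,
  ⟨-4, 2, [(0,1),(0,2),(0,4),(2,3)], [(0,5)], [⟨6, 6, 4, 5, st 145 6, go 104 [] [3] [0,3,2,4,5]⟩]⟩,
  ⟨-3, 2, [(0,2),(0,3),(1,2)], [(0,4)], [⟨4, 7, 2, 5, go 37 [] [] [0,1,2,5,3,4], go 103 [] [] [0,1,2,3,5,4]⟩,
    ⟨8, 24, 2, 5, gr 10 [4] [3,5] [5,4,2], go 103 [] [] [0,1,2,3,5,4]⟩]⟩]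

def fams3 : List Fam := [
  ⟨-5, 2, [(0,2),(0,5),(1,2),(2,3),(3,4)], [(0,6)], [⟨7, 7, 2, 7, go 53 [] [] [0,1,2,3,7,4,5,6], go 243 [] [] [0,1,2,3,4,5,7,6]⟩]⟩,
  ⟨-5, 2, [(0,2),(0,4),(0,5),(1,2),(1,6),(2,3)], [], [⟨6, 6, 4, 7, wn [6,3,4] [5,7,2], st 70 8⟩]⟩,
  ⟨-5, 2, [(0,2),(0,4),(0,5),(1,2),(2,3)], [(1,6)], [⟨6, 6, 2, 6, st 244 7, st 242 7⟩]⟩,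
  ⟨-5, 2, [(0,2),(0,3),(0,4),(1,2),(2,5),(3,6)], [], [⟨9, 10, 0, 7, go 56 [] [] [0,1,2,3,4,7,5,6], st 71 8⟩,
    ⟨11, 24, 0, 7, go 58 [] [4,5] [0,5,2,3,7,6], go 6 [7] [3,5,4,6,2] [7,2]⟩]⟩,
  ⟨-5, 2, [(0,2),(0,4),(0,5),(1,2),(2,3)], [(4,6)], [⟨5, 5, 5, 6, wn [] [5,3,4,6,2], go 2 [] [4,6,5,3] [0,3,2]⟩]⟩,
  ⟨-5, 2, [(0,3),(2,3),(2,4),(2,5),(3,6),(4,7)], [], [⟨6, 6, 1, 6, wn [4,6,5,7,3] [2], go 2 [4] [6,5,7,3] [4,3,2]⟩]⟩,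
  ⟨-6, 2, [(0,2),(1,2),(2,3),(2,4),(3,5),(3,6)], [(0,7)], [⟨6, 6, 5, 8, wn [7] [5,4,6,8,2], gr 234 [7] [] [1,7,2,3,4,5,6,8]⟩]⟩,
  ⟨-5, 2, [(0,1),(0,2),(0,5),(2,3),(2,4)], [(2,6)], [⟨7, 7, 2, 7, go 247 [] [] [0,1,2,3,4,7,5,6], st 249 8⟩]⟩,
  ⟨-6, 2, [(0,2),(0,6),(1,2),(2,3),(2,4),(3,5)], [(0,7)], [⟨7, 7, 5, 7, gr 164 [7] [] [1,7,0,3,2,5,6,4], go 2 [7,5,4,6,3] [] [3,1,2]⟩]⟩,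
  ⟨-4, 3, [(0,3),(2,3),(2,7),(3,4),(3,5),(4,6)], [], [⟨5, 5, 1, 6, wn [6,5,7,4] [3], go 2 [7,4] [6,5] [4,5,3]⟩]⟩,
  ⟨-6, 2, [(0,2),(0,5),(0,6),(1,2),(1,7),(2,3),(2,4)], [], [⟨7, 7, 5, 8, wn [7,3,5,4,6,8,2] [], go 65 [] [5,8] [0,8,1,2,3,4,7,6]⟩]⟩,
  ⟨-6, 2, [(0,2),(0,3),(0,4),(0,5),(1,2),(2,6),(3,7)], [], [⟨8, 10, 2, 8, go 248 [] [4] [0,4,2,6,8,3,5,7], go 255 [] [4] [0,4,2,3,5,6,7,8]⟩]⟩,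
  ⟨-5, 2, [(0,1),(0,2),(0,3),(0,4),(1,6),(2,5)], [], [⟨6, 6, 1, 7, wn [] [5,3,6,2,7,4], st 254 8⟩]⟩,
  ⟨-4, 2, [(0,2),(0,3),(0,4),(1,2),(3,5)], [], [⟨6, 6, 4, 6, st 150 7, st 151 7⟩,
    ⟨7, 8, 0, 6, go 148 [] [] [0,1,2,3,4,6,5], st 149 7⟩,
    ⟨9, 24, 2, 6, go 48 [] [] [0,1,2,3,4,6,5], go 10 [] [4,5,2,6] [0,6,3]⟩]⟩,
  ⟨-6, 2, [(0,2),(0,5),(0,6),(1,2),(2,3),(2,4),(5,7)], [], [⟨8, 8, 3, 8, go 252 [] [5] [0,5,2,3,4,6,8,7], go 253 [] [5] [0,5,2,3,4,6,8,7]⟩]⟩]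

def fams4 : List Fam := [
  ⟨-4, 2, [(0,2),(0,3),(0,4),(1,2)], [(2,5)], [⟨5, 5, 1, 5, st 153 6, go 90 [] [5,2] [0,2,3,4]⟩]⟩,
  ⟨-5, 2, [(0,1),(0,2),(0,3),(0,4),(2,5)], [(1,6)], [⟨6, 6, 2, 6, st 258 7, st 256 7⟩]⟩,
  ⟨-5, 2, [(0,1),(0,2),(0,3),(0,4),(2,5)], [(3,6)], [⟨7, 7, 3, 7, go 255 [] [] [0,1,3,2,4,7,5,6], st 259 8⟩]⟩,
  ⟨-6, 2, [(0,2),(0,5),(1,2),(1,6),(2,3),(2,4)], [(2,7)], [⟨6, 6, 0, 7, wn [6,3,5,4,7,2] [], wn [7,2] [5,3,6,4]⟩]⟩,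
  ⟨-6, 2, [(0,2),(0,5),(1,2),(1,6),(2,3),(2,4)], [(0,7)], [⟨7, 7, 5, 7, gr 261 [7] [] [1,7,0,2,3,4,5,6], go 2 [7,5,3,6,4] [] [4,1,2]⟩]⟩,
  ⟨-4, 3, [(0,3),(0,7),(2,3),(2,6),(3,4),(3,5)], [], [⟨5, 5, 4, 8, wn [6,4,7,5,8] [], wn [6,5,7,4,8] []⟩]⟩,
  ⟨-3, 4, [(0,1),(0,4),(2,3),(2,4),(2,5),(3,6)], [], [⟨4, 4, 1, 7, wn [5,6,4,7] [], wn [5,6,4] [7]⟩]⟩,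
  ⟨-4, 3, [(0,2),(0,6),(1,4),(2,3),(2,5),(3,4)], [], [⟨5, 5, 1, 7, wn [4,5,6,3,7] [], wn [4,5,6,3] [7]⟩]⟩,
  ⟨-3, 3, [(0,1),(0,2),(0,3),(1,5),(2,4)], [], [⟨4, 4, 0, 6, wn [] [4,3,5,6], wn [6] [4,3,5]⟩]⟩,
  ⟨-6, 2, [(0,2),(0,4),(0,5),(1,2),(1,6),(2,3),(4,7)], [], [⟨7, 7, 2, 8, wn [6,3,4,8,5,7,2] [], wn [6,3,4] [5,7,2,8]⟩]⟩,
  ⟨-6, 2, [(0,2),(0,4),(0,5),(1,2),(1,6),(2,3)], [(4,7)], [⟨6, 6, 5, 7, wn [6,3,4,7,2] [5], gr 262 [6] [] [1,6,0,2,3,4,5,7]⟩]⟩,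
  ⟨-6, 2, [(0,2),(0,3),(0,4),(1,2),(2,5),(3,6)], [(0,7)], [⟨9, 9, 2, 8, go 251 [] [3] [0,3,2,5,8,4,7,6], go 1 [7] [3,5,4,6,2,8] [7,8]⟩,
    ⟨10, 10, 7, 8, go 260 [] [3] [0,3,2,4,5,6,7,8], go 1 [7,8] [3,5,4,6,2] [8,2]⟩]⟩,
  ⟨-4, 2, [(0,2),(0,3),(1,2),(3,4)], [(2,5)], [⟨4, 4, 1, 5, wn [5,2,4] [3], go 2 [] [5,2,4] [0,4,3]⟩]⟩,
  ⟨-4, 2, [(0,2),(0,4),(1,4),(2,3)], [(2,5)], [⟨4, 4, 0, 3, wn [] [3,4,2,5], wn [3,4] [2,5]⟩]⟩,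
  ⟨-3, 3, [(0,2),(0,6),(2,3),(2,4),(3,5)], [], [⟨7, 7, 1, 7, st 166 8, go 1 [5,4,6,3] [7] [3,7]⟩]⟩]

def fams5 : List Fam := [
  ⟨-6, 2, [(0,2),(0,3),(0,4),(1,2),(2,5),(3,6)], [(3,7)], [⟨6, 6, 0, 7, wn [] [3,7,5,4,6,2], wn [7,3,5,4,6,2] []⟩]⟩,
  ⟨-6, 2, [(0,2),(0,4),(0,5),(1,2),(2,3),(4,6)], [(3,7)], [⟨7, 7, 5, 8, wn [] [4,8,2,6,5,3,7], go 168 [] [4,3] [0,3,4,2,5,6,7,8]⟩]⟩,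
  ⟨-3, 3, [(0,1),(0,2),(0,3),(2,4)], [(1,5)], [⟨3, 3, 0, 5, wn [] [5,4,3], wn [5] [4,3]⟩]⟩,
  ⟨-3, 3, [(0,1),(0,2),(0,3),(2,4)], [(4,5)], [⟨3, 3, 1, 5, wn [] [4,5,3], wn [] [5,4,3]⟩]⟩,
  ⟨0, 3, [(0,2),(0,3),(1,2)], [], [⟨2, 2, 3, 4, st 93 5, wn [] [3,4]⟩]⟩,
  ⟨-1, 2, [(0,2),(0,3),(1,2)], [], [⟨2, 2, 1, 4, wn [4] [3], st 119 5⟩,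
    ⟨3, 6, 2, 4, go 2 [] [3,4] [0,4,2], st 120 5⟩,
    ⟨7, 23, 0, 4, go 90 [] [3] [0,3,2,4], st 118 5⟩]⟩,
  ⟨-1, 2, [(0,2),(1,2)], [(0,3)], [⟨2, 23, 2, 3, go 2 [3] [] [3,1,2], go 1 [3,2] [] [2,1]⟩]⟩,
  ⟨-1, 2, [(0,2),(1,2)], [(2,3)], [⟨4, 5, 0, 3, go 4 [] [3,2] [0,2], go 1 [3,2] [] [2,1]⟩]⟩,
  ⟨-1, 2, [(0,2)], [(2,3)], [⟨5, 5, 1, 2, st 35 4, go 1 [] [2,3] [0,3]⟩]⟩,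
  ⟨-2, 2, [(0,2),(0,3)], [(0,4)], [⟨4, 24, 1, 2, st 44 5, st 121 5⟩]⟩,
  ⟨-2, 2, [(0,2),(2,3)], [(2,4)], [⟨5, 5, 1, 2, st 19 5, st 122 5⟩]⟩,
  ⟨-3, 2, [(0,2),(1,2)], [(2,3),(2,4)], [⟨5, 5, 0, 3, st 102 5, go 1 [3,2,4] [] [4,1]⟩]⟩,
  ⟨-3, 2, [(0,1),(0,2)], [(1,4),(2,3)], [⟨3, 3, 0, 3, st 105 5, wn [3,2] [4]⟩]⟩,
  ⟨-3, 3, [(0,3),(1,2),(2,3)], [(1,5),(3,4)], [⟨4, 4, 0, 4, st 112 6, go 1 [4,3] [5] [3,5]⟩]⟩,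
  ⟨0, 2, [(0,2)], [(2,3)], [⟨4, 5, 1, 2, st 82 4, go 4 [] [2] [0,2]⟩]⟩]

def fams6 : List Fam := [
  ⟨-1, 2, [(0,1),(0,2),(0,3)], [], [⟨3, 24, 2, 4, st 129 5, st 174 5⟩]⟩,
  ⟨-1, 2, [(0,1),(0,2)], [(0,3)], [⟨3, 3, 2, 3, st 178 4, go 1 [3,2] [] [2,1]⟩,
    ⟨5, 5, 2, 3, st 178 4, go 1 [3,2] [] [2,1]⟩,
    ⟨6, 24, 1, 3, go 3 [3,2] [] [2,1,0], go 10 [] [3] [0,3,2]⟩]⟩,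
  ⟨-1, 2, [(0,1),(0,2)], [(2,3)], [⟨2, 2, 0, 3, st 173 4, wn [3,2] []⟩,
    ⟨4, 4, 0, 4, go 174 [] [] [0,1,2,4,3], go 227 [] [] [0,1,2,4,3]⟩]⟩,
  ⟨-1, 3, [(0,2),(0,3),(1,2),(3,4)], [], [⟨2, 2, 0, 5, wn [] [5,4], wn [5] [3]⟩]⟩,
  ⟨-2, 2, [(2,3),(2,4)], [(0,5)], [⟨5, 5, 1, 3, gr 100 [] [] [1,0,3,2,4,5], gr 171 [] [] [1,0,2,3,4,5]⟩]⟩,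
  ⟨-3, 2, [(0,2),(0,3),(0,4),(2,3)], [], [⟨4, 4, 2, 5, wn [5,3,4,2] [], st 175 6⟩]⟩,
  ⟨-3, 2, [(0,2),(0,3),(0,4)], [(2,3)], [⟨4, 4, 4, 5, go 130 [] [] [0,1,4,2,3,5], st 177 6⟩]⟩,
  ⟨-3, 2, [(0,2),(2,3),(2,4)], [(1,3)], [⟨7, 24, 1, 2, go 16 [] [3] [0,3,2,4], go 16 [] [3] [0,3,2,4]⟩]⟩,
  ⟨-3, 2, [(0,2),(2,3),(2,4)], [(0,5)], [⟨6, 6, 1, 6, go 134 [] [] [0,1,2,3,4,6,5], gr 94 [5] [] [1,5,2,3,4,6]⟩]⟩,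
  ⟨-3, 2, [(0,2),(2,3),(2,4)], [(3,5)], [⟨5, 5, 0, 5, st 264 6, st 263 6⟩]⟩,
  ⟨-3, 2, [(0,2),(2,3),(3,4)], [(1,5)], [⟨5, 5, 4, 5, go 2 [4] [5,2] [4,2,3], st 265 6⟩]⟩,
  ⟨-4, 2, [(0,2),(1,2),(2,3)], [(0,5),(2,4)], [⟨4, 4, 1, 4, gr 143 [] [] [1,0,2,3,4,5], gr 181 [] [] [1,0,2,3,4,5]⟩,
    ⟨5, 24, 2, 5, go 19 [5] [] [5,1,2,3,4], go 182 [] [] [0,1,2,3,5,4]⟩]⟩,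
  ⟨-4, 2, [(0,2),(0,3),(1,2)], [(2,3),(2,4)], [⟨5, 5, 0, 5, go 154 [] [] [0,1,2,3,5,4], go 1 [5] [3,2,4] [5,4]⟩]⟩,
  ⟨-4, 2, [(0,2),(0,3),(1,2)], [(0,5),(2,4)], [⟨4, 4, 3, 5, go 6 [5,2,4] [3] [4,3], go 183 [] [] [0,1,2,3,5,4]⟩,
    ⟨5, 8, 3, 6, go 156 [] [] [0,1,2,3,6,5,4], gr 193 [5] [] [1,5,0,2,3,4,6]⟩,
    ⟨9, 24, 3, 5, go 6 [5,2,4] [3] [4,3], go 183 [] [] [0,1,2,3,5,4]⟩]⟩,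
  ⟨-4, 2, [(0,2),(0,3),(1,2)], [(0,4),(3,4)], [⟨5, 5, 2, 5, go 2 [4,3,5] [] [5,1,2], st 183 6⟩]⟩]

def fams7 : List Fam := [
  ⟨-4, 2, [(0,1),(0,2),(0,3)], [(1,4),(2,3)], [⟨3, 3, 2, 4, wn [] [4,3,2], wn [] [4,2,3]⟩,
    ⟨4, 4, 2, 5, go 147 [] [] [0,1,2,5,3,4], go 188 [] [] [0,1,2,3,5,4]⟩]⟩,
  ⟨-4, 3, [(0,3),(1,3),(2,3),(2,4)], [(3,5),(4,6)], [⟨4, 4, 0, 5, wn [4,6] [5,3], wn [5,3] [4,6]⟩,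
    ⟨5, 5, 0, 5, st 200 7, go 1 [5,3] [4,6] [3,6]⟩]⟩,
  ⟨-4, 3, [(0,2),(0,3),(1,3),(2,4)], [(0,5),(4,6)], [⟨4, 4, 1, 6, go 204 [] [] [0,1,2,3,4,6,5], wn [5] [6,4,3]⟩]⟩,
  ⟨-4, 3, [(0,3),(1,2),(1,6),(2,3),(2,5),(3,4)], [], [⟨5, 5, 0, 7, wn [5,6,3] [4,7], wn [7] [4,5,6,3]⟩]⟩,
  ⟨-4, 3, [(0,4),(1,5),(2,3),(2,5),(3,4)], [(5,6)], [⟨5, 5, 3, 7, go 198 [7] [] [7,1,2,3,5,4,6], gr 107 [] [3] [3,0,2,4,5,7,6]⟩]⟩,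
  ⟨-4, 3, [(0,3),(1,2),(2,3),(2,4),(4,6)], [(3,5)], [⟨6, 6, 4, 7, go 196 [4] [] [4,1,2,6,7,3,5], go 1 [4,7] [6,3,5] [7,5]⟩]⟩,
  ⟨-4, 3, [(0,3),(1,2),(2,3),(2,4),(4,5)], [(4,6)], [⟨5, 5, 1, 7, wn [4,6] [5,3,7], go 116 [] [7] [0,7,2,3,4,5,6]⟩]⟩,
  ⟨-4, 3, [(0,3),(0,4),(1,2),(2,3)], [(1,5),(3,4)], [⟨4, 4, 3, 6, go 206 [] [] [0,1,2,3,6,4,5], go 211 [] [] [0,1,2,3,4,6,5]⟩]⟩,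
  ⟨-4, 3, [(0,1),(0,2),(0,3),(2,4)], [(1,3),(3,5)], [⟨4, 4, 0, 6, go 77 [] [3] [0,3,2,6,4,5], wn [6] [4,3,5]⟩]⟩,
  ⟨-4, 3, [(0,1),(0,2),(0,3),(2,4)], [(3,5)], [⟨4, 4, 4, 6, wn [6] [4,3,5], st 215 7⟩]⟩,
  ⟨-3, 3, [(0,3),(2,3),(2,4),(4,5),(4,6)], [], [⟨4, 4, 1, 5, wn [4] [6,3,5], wn [4] [5,3,6]⟩]⟩,
  ⟨-3, 3, [(0,3),(2,3),(2,4),(4,5)], [(4,6)], [⟨4, 4, 1, 4, wn [4,6] [3,5], st 216 7⟩]⟩,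
  ⟨-4, 3, [(0,1),(0,2),(0,3),(0,5),(2,4)], [(4,5)], [⟨4, 4, 3, 6, wn [] [6,5,4,3], st 219 7⟩]⟩,
  ⟨-2, 2, [(0,2),(0,3),(1,2)], [(0,4)], [⟨7, 23, 3, 4, go 3 [4,2] [3] [2,3,0], go 10 [] [3,4] [0,4,2]⟩]⟩,
  ⟨-2, 2, [(0,2),(0,3),(1,2)], [(1,4)], [⟨2, 2, 2, 4, wn [] [4,3], wn [] [4,2]⟩]⟩]

def fams8 : List Fam := [
  ⟨-2, 2, [(0,2),(0,3),(1,2)], [(2,4)], [⟨3, 3, 0, 4, go 228 [] [] [0,1,2,4,3], wn [4,2] [3]⟩,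
    ⟨4, 6, 1, 4, go 3 [4,2] [3] [2,3,0], go 4 [] [4,2] [0,2]⟩]⟩,
  ⟨-3, 2, [(0,2),(0,3)], [(0,4),(1,2)], [⟨4, 6, 3, 4, go 178 [] [2] [0,2,3,4], go 1 [4,3] [2] [3,2]⟩,
    ⟨7, 24, 2, 4, go 3 [4,3] [2] [3,2,0], go 10 [] [2,4] [0,4,3]⟩]⟩,
  ⟨-3, 2, [(0,2),(2,3)], [(1,2),(2,4)], [⟨5, 5, 3, 4, gr 178 [] [2] [2,0,3,4], go 1 [] [2,4,3] [0,3]⟩]⟩,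
  ⟨-2, 2, [(0,2),(0,4),(1,3),(2,3)], [], [⟨3, 3, 1, 4, wn [3,4,2] [], go 2 [] [4,3] [0,3,2]⟩]⟩,
  ⟨-2, 3, [(0,2),(2,3)], [(0,4),(3,5)], [⟨4, 4, 1, 3, gr 88 [] [] [1,0,2,3,5,4], go 1 [4] [3,5] [4,5]⟩]⟩,
  ⟨-4, 3, [(0,2),(0,3),(1,2),(2,4)], [(0,4),(3,5)], [⟨4, 4, 1, 6, wn [4,6] [3,5], wn [4,3,5] [6]⟩]⟩,
  ⟨-4, 3, [(0,3),(1,4),(2,3),(2,4)], [(1,3),(4,5)], [⟨4, 4, 3, 6, gr 78 [] [3] [3,0,2,6,4,5], wn [4,5] [3,6]⟩]⟩,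
  ⟨-3, 2, [(2,3),(2,4),(3,5)], [(0,4)], [⟨4, 4, 1, 3, gr 131 [] [] [1,0,3,2,5,4], go 2 [4] [3] [4,3,2]⟩]⟩,
  ⟨-3, 2, [(0,5),(2,3),(2,4)], [(0,2)], [⟨5, 5, 2, 5, go 14 [2] [] [2,1,3,4,5], go 84 [2] [] [2,1,3,4,5]⟩]⟩,
  ⟨-2, 2, [(0,1),(0,2),(0,3),(2,4)], [], [⟨3, 3, 2, 3, wn [4,3] [2], wn [] [4,3,2]⟩,
    ⟨4, 4, 1, 5, wn [] [4,3,5,2], st 191 6⟩,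
    ⟨5, 24, 0, 5, go 90 [] [4,3] [0,3,2,5], st 190 6⟩]⟩,
  ⟨-4, 2, [(0,2),(0,3),(0,4),(2,5)], [(3,4)], [⟨4, 4, 2, 3, wn [5,3,4,2] [], st 266 6⟩]⟩,
  ⟨-4, 2, [(0,2),(2,3),(2,4),(3,5)], [(1,5)], [⟨4, 4, 0, 3, wn [4,3] [5,2], go 2 [3] [5,4] [3,4,2]⟩]⟩,
  ⟨-4, 2, [(0,2),(2,3),(2,4),(3,4),(3,5)], [], [⟨5, 5, 2, 6, wn [3,6,4,5,2] [], go 175 [3] [] [3,1,2,4,5,6]⟩]⟩,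
  ⟨-4, 2, [(0,2),(2,3),(2,4),(3,5)], [(3,4)], [⟨4, 4, 1, 5, wn [5,4,3] [2], go 2 [] [5,4,3] [0,3,2]⟩,
    ⟨5, 5, 1, 5, go 140 [] [] [0,1,3,2,5,4], go 2 [] [5,4,3] [0,3,2]⟩]⟩,
  ⟨-4, 2, [(0,2),(1,5),(2,3),(2,4)], [(0,6)], [⟨6, 6, 1, 2, gr 41 [] [] [1,0,2,3,4,5,6], gr 128 [6] [] [1,6,2,3,4,5]⟩]⟩]

def fams9 : List Fam := [
  ⟨-5, 2, [(0,2),(0,4),(1,2),(1,3),(2,3)], [(2,5)], [⟨5, 5, 1, 6, wn [3,6,2,5] [4], go 209 [] [6] [0,6,1,2,3,4,5]⟩]⟩,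
  ⟨-5, 2, [(0,2),(1,2),(2,3),(2,4)], [(0,6),(3,5)], [⟨6, 6, 1, 5, gr 264 [6] [] [1,6,2,3,4,5], gr 263 [6] [] [1,6,2,3,4,5]⟩]⟩,
  ⟨-5, 2, [(0,3),(1,3),(2,3),(2,4)], [(0,2),(2,5)], [⟨4, 4, 4, 5, wn [2,5,3] [4], st 273 6⟩]⟩,
  ⟨-5, 2, [(0,2),(0,4),(1,2),(2,3)], [(1,3),(2,5)], [⟨5, 5, 4, 6, go 72 [] [3] [0,3,2,4,6,5], go 87 [] [3,4] [0,4,2,5,6]⟩]⟩,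
  ⟨-5, 2, [(0,2),(0,4),(1,2),(2,3)], [(2,5),(2,6)], [⟨6, 9, 0, 5, go 144 [] [4] [0,4,2,3,5,6], go 1 [5,2,6] [4,3] [6,3]⟩,
    ⟨10, 24, 0, 5, go 6 [] [4,3,5,2,6] [0,6], go 1 [5,2,6] [4,3] [6,3]⟩]⟩,
  ⟨-5, 2, [(0,3),(1,4),(2,3),(2,4),(3,5)], [(2,5)], [⟨5, 5, 1, 6, wn [4,5,2,6] [3], go 133 [] [6] [0,6,3,2,5,4]⟩]⟩,
  ⟨-5, 2, [(0,2),(0,4),(1,2),(2,3),(4,5)], [(0,5)], [⟨5, 5, 4, 6, wn [5,2,6] [4,3], gr 198 [5] [] [1,5,0,2,4,3,6]⟩,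
    ⟨6, 6, 1, 6, go 68 [5,2] [] [2,1,0,3,4,6], gr 197 [5] [] [1,5,0,2,4,6,3]⟩]⟩,
  ⟨-5, 2, [(0,2),(0,4),(1,2),(2,3)], [(0,5),(3,6)], [⟨7, 7, 5, 6, st 246 7, go 2 [5,6,3] [] [3,1,2]⟩]⟩,
  ⟨-5, 2, [(0,2),(0,4),(1,2),(2,3)], [(1,5),(2,4)], [⟨4, 4, 4, 5, wn [] [5,2,4,3], st 274 6⟩]⟩,
  ⟨-5, 2, [(0,1),(0,2),(0,4),(2,3)], [(2,4),(2,5)], [⟨5, 5, 1, 5, st 275 6, go 3 [] [5,2,4,3] [0,3,2]⟩,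
    ⟨6, 6, 3, 5, st 276 6, go 4 [] [3,5,2,4] [0,4]⟩,
    ⟨7, 8, 0, 6, go 154 [] [3] [0,3,2,4,6,5], go 1 [6] [3,4,2,5] [6,5]⟩]⟩,
  ⟨-5, 2, [(0,1),(0,2),(0,4),(2,3),(4,5)], [(0,5)], [⟨6, 6, 2, 6, go 250 [] [] [0,1,2,3,6,4,5], go 111 [5] [] [5,1,0,4,2,3,6]⟩]⟩,
  ⟨-5, 2, [(0,1),(0,2),(0,4),(0,5),(2,3)], [(1,5)], [⟨7, 7, 0, 6, go 257 [] [] [0,1,2,4,6,3,5], go 43 [] [5] [0,5,2,3,4,6]⟩]⟩,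
  ⟨-5, 2, [(0,1),(0,2),(0,4),(2,3)], [(1,5),(2,4)], [⟨4, 4, 0, 5, wn [] [5,3,4,2], wn [5] [3,4,2]⟩]⟩,
  ⟨-5, 2, [(0,2),(0,3),(0,4),(0,5),(1,2),(3,6)], [], [⟨7, 7, 4, 7, go 57 [] [3] [0,3,4,2,5,7,6], go 61 [] [4] [0,4,3,2,5,6,7]⟩,
    ⟨8, 8, 2, 7, go 56 [] [] [0,1,2,3,4,5,7,6], go 62 [] [4] [0,4,3,2,5,6,7]⟩]⟩,
  ⟨-5, 2, [(0,2),(0,3),(0,4),(1,2),(3,5)], [(0,6)], [⟨7, 8, 3, 6, go 161 [6] [] [6,1,0,3,5,2,4], go 3 [6,3] [4,5,2] [3,2,0]⟩]⟩]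

def fams10 : List Fam := [
  ⟨-5, 2, [(0,2),(0,3),(0,4),(1,2),(3,5),(4,6)], [], [⟨6, 6, 3, 7, wn [] [3,6,2,5,4,7], wn [] [4,5,2,6,3,7]⟩]⟩,
  ⟨-5, 2, [(0,2),(0,3),(0,4),(1,2),(3,5)], [(4,6)], [⟨6, 6, 2, 6, go 245 [] [] [0,1,2,6,3,5,4], go 2 [] [4,6,2,5] [0,5,3]⟩]⟩,
  ⟨-5, 2, [(0,2),(0,5),(1,5),(2,3),(2,4)], [(3,6)], [⟨5, 5, 1, 6, wn [6,3,5,4] [2], go 2 [] [6,3,5,4] [0,4,2]⟩]⟩,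
  ⟨-5, 2, [(0,2),(0,3),(0,4),(1,2),(1,5)], [(2,5)], [⟨5, 5, 2, 6, wn [5,2] [3,6,4], gr 208 [5] [] [1,5,0,2,3,6,4]⟩]⟩,
  ⟨-5, 2, [(0,2),(0,3),(0,4),(1,2)], [(2,3),(2,5)], [⟨5, 5, 4, 6, go 187 [] [4] [0,4,2,3,5,6], go 87 [] [3,2] [0,2,4,6,5]⟩,
    ⟨6, 6, 4, 6, go 187 [] [4] [0,4,2,3,5,6], go 185 [] [3] [0,3,2,4,5,6]⟩,
    ⟨7, 7, 0, 6, go 184 [] [3] [0,3,2,4,5,6], gr 207 [6] [] [1,6,0,2,3,4,5]⟩]⟩,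
  ⟨-5, 2, [(0,2),(0,3),(0,4),(1,2)], [(2,5),(3,4)], [⟨4, 4, 2, 3, wn [] [3,4,2,5], wn [] [4,3,2,5]⟩]⟩,
  ⟨-5, 2, [(0,2),(0,3),(1,2),(3,4)], [(0,5),(2,6)], [⟨5, 5, 3, 6, go 281 [5] [] [5,1,0,2,3,4,6], wn [5] [3,6,2,4]⟩,
    ⟨6, 6, 4, 5, go 109 [5] [] [5,1,0,3,4,2,6], go 1 [5,4,2,6] [3] [6,3]⟩,
    ⟨7, 8, 3, 6, go 281 [5] [] [5,1,0,2,3,4,6], go 1 [5] [3,6,2,4] [5,4]⟩]⟩,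
  ⟨-5, 2, [(0,2),(0,3),(1,2),(3,4),(3,5)], [(2,5)], [⟨5, 5, 4, 6, wn [6,5,2,4] [3], gr 186 [] [3] [3,0,5,4,2,6]⟩]⟩,
  ⟨-3, 5, [(0,3),(2,4),(2,5),(2,8),(3,5),(4,7),(5,6)], [], [⟨5, 5, 1, 6, go 66 [6] [] [6,1,2,4,5,8,7], go 3 [] [6,8,7,5] [0,5,3]⟩]⟩,
  ⟨-3, 4, [(0,2),(1,3),(2,3),(2,4),(3,5)], [(4,6)], [⟨4, 4, 1, 7, wn [5,7] [4,6], wn [5,4,6] [7]⟩]⟩,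
  ⟨-2, 3, [(0,2),(0,3),(1,3),(2,3)], [(3,4)], [⟨2, 2, 0, 4, wn [] [4,3], wn [4,3] []⟩]⟩,
  ⟨-4, 3, [(0,3),(1,5),(2,3),(2,5),(2,6),(3,4)], [], [⟨6, 6, 6, 7, go 108 [] [6] [0,6,2,3,4,5,7], gr 277 [5] [] [1,5,2,3,4,6,7]⟩,
    ⟨7, 7, 5, 7, go 170 [] [] [0,1,2,3,4,5,7,6], gr 110 [6] [] [1,6,2,5,3,7,4]⟩]⟩,
  ⟨-5, 3, [(0,1),(0,3),(2,3),(2,5),(3,4),(5,6)], [(1,6)], [⟨5, 5, 5, 7, wn [5,4] [6,3,7], go 198 [] [6] [0,6,2,3,5,4,7]⟩]⟩,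
  ⟨-5, 3, [(0,4),(1,2),(1,7),(2,3),(2,6),(3,4),(3,5)], [], [⟨7, 7, 4, 8, gr 67 [5,8] [] [1,8,2,3,4,6,7], go 158 [] [4,8] [0,8,2,4,1,3,5,7,6]⟩]⟩,
  ⟨-5, 3, [(0,4),(1,5),(2,4),(2,6),(3,4),(3,5),(4,7)], [], [⟨6, 6, 1, 8, wn [5,7,6,3,8] [4], go 54 [] [8] [0,8,2,4,3,7,5,6]⟩]⟩]

def fams11 : List Fam := [
  ⟨-5, 3, [(0,2),(0,3),(0,6),(1,3),(2,5),(3,4)], [(5,6)], [⟨5, 5, 1, 7, wn [7,4,6,5,3] [], go 278 [] [7] [0,7,2,3,4,6,5]⟩,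
    ⟨6, 6, 1, 7, go 213 [7,4] [] [4,1,2,0,3,6,5], go 278 [] [7] [0,7,2,3,4,6,5]⟩]⟩,
  ⟨-4, 3, [(0,2),(0,6),(1,7),(2,3),(2,4),(3,5)], [], [⟨7, 7, 3, 7, gr 163 [] [] [1,0,2,3,7,5,4,6], go 4 [5,4,6,3,7] [] [7,1]⟩]⟩,
  ⟨-2, 3, [(0,2),(2,3),(2,4),(3,5),(4,6)], [], [⟨4, 4, 1, 3, go 4 [6,3] [4,5] [3,5], go 3 [5,4] [3] [4,3,2]⟩,
    ⟨5, 5, 1, 3, gr 222 [] [] [1,0,2,3,5,4,6], go 3 [5,4] [3] [4,3,2]⟩,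
    ⟨6, 6, 1, 3, go 4 [6,3] [4,5] [3,5], go 3 [5,4] [3] [4,3,2]⟩]⟩,
  ⟨-5, 3, [(0,2),(0,3),(0,4),(1,3),(2,5)], [(1,6),(4,7)], [⟨5, 5, 1, 7, wn [7,4,5,3] [6], go 217 [] [6] [0,6,2,4,3,5,7]⟩]⟩,
  ⟨-5, 3, [(0,2),(0,3),(0,4),(0,6),(1,3),(2,5)], [(5,6)], [⟨5, 5, 3, 7, wn [] [4,7,6,5,3], go 219 [] [4] [0,4,2,3,5,6,7]⟩]⟩,
  ⟨-5, 3, [(0,3),(1,5),(2,3),(2,5),(2,7),(3,4),(5,6)], [], [⟨7, 7, 3, 8, gr 195 [5] [3] [3,5,2,4,8,6,7], go 159 [5,4,7] [] [7,1,2,5,3,6,8]⟩]⟩,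
  ⟨-3, 2, [(2,3),(2,4)], [(0,3),(1,5)], [⟨5, 5, 2, 5, go 2 [3] [5] [3,5,2], go 1 [3] [5,2] [3,2]⟩]⟩,
  ⟨-3, 2, [(2,3),(2,4)], [(0,3),(4,5)], [⟨4, 4, 1, 4, gr 180 [] [] [1,0,4,2,3,5], go 2 [3] [4] [3,4,2]⟩]⟩,
  ⟨-2, 2, [(0,1),(0,2),(0,3)], [(2,3)], [⟨2, 2, 1, 2, wn [] [3,2], wn [] [2,3]⟩]⟩,
  ⟨-2, 2, [(0,1),(0,2),(0,3)], [(2,4)], [⟨3, 24, 3, 4, st 289 5, st 290 5⟩]⟩,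
  ⟨-4, 2, [(0,2),(0,3),(0,4),(2,3)], [(2,5)], [⟨4, 4, 1, 2, wn [] [3,4,2,5], go 288 [] [2] [0,2,3,4,5]⟩]⟩,
  ⟨-4, 2, [(0,2),(0,3),(0,4)], [(2,3),(2,4)], [⟨3, 3, 1, 3, wn [] [4,2,3], wn [] [3,2,4]⟩]⟩,
  ⟨-4, 2, [(0,2),(0,3),(0,4)], [(2,3),(4,5)], [⟨4, 4, 1, 4, go 155 [] [] [0,1,4,2,3,5], go 230 [] [4] [0,4,2,3,5]⟩]⟩,
  ⟨-2, 2, [(0,1),(0,2),(2,3)], [(0,3)], [⟨3, 3, 1, 4, go 192 [] [] [0,1,2,4,3], st 231 5⟩,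
    ⟨4, 5, 2, 4, go 2 [3] [4] [3,4,2], st 232 5⟩]⟩,
  ⟨-2, 2, [(0,2),(0,3),(2,4)], [(1,2)], [⟨4, 4, 0, 4, go 3 [] [2,3,4] [0,4,2], go 4 [4] [2] [4,2]⟩]⟩]

def fams12 : List Fam := [
  ⟨-4, 2, [(0,2),(2,3),(3,4)], [(1,4),(2,5)], [⟨4, 4, 0, 5, go 269 [] [] [0,1,2,3,5,4], go 2 [5,2] [4] [2,4,3]⟩]⟩,
  ⟨-5, 2, [(0,2),(1,2),(2,3)], [(0,4),(1,5),(2,4)], [⟨4, 4, 3, 5, go 2 [4,2] [5] [2,5,3], wn [4,2] [5,3]⟩]⟩,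
  ⟨-5, 2, [(0,2),(1,2),(2,3)], [(0,4),(2,4),(2,5)], [⟨5, 7, 3, 5, go 272 [] [] [0,1,2,3,5,4], go 1 [4,2,5,3] [] [3,1]⟩,
    ⟨8, 24, 1, 5, go 3 [4,2,5,3] [] [3,1,2], go 10 [4,2] [5] [2,5,3]⟩]⟩,
  ⟨-5, 2, [(0,2),(0,3),(1,2)], [(0,4),(2,5),(3,4)], [⟨4, 4, 0, 5, go 3 [4,3] [5,2] [3,2,0], go 6 [5,2] [3,4] [2,4]⟩,
    ⟨5, 5, 1, 5, go 280 [] [] [0,1,2,3,5,4], go 1 [4,3] [5,2] [3,2]⟩,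
    ⟨9, 24, 0, 5, go 3 [4,3] [5,2] [3,2,0], go 6 [5,2] [3,4] [2,4]⟩]⟩,
  ⟨-5, 2, [(0,1),(0,2),(0,3),(0,5)], [(1,2),(2,4)], [⟨6, 6, 0, 6, go 14 [] [2,4] [0,4,3,5,6], go 84 [] [2,4] [0,4,3,5,6]⟩]⟩,
  ⟨-5, 2, [(0,1),(0,2),(0,3)], [(1,2),(2,4),(3,5)], [⟨5, 5, 0, 5, go 105 [] [2] [0,2,3,5,4], go 1 [5,3] [2,4] [3,4]⟩]⟩,
  ⟨-5, 2, [(0,1),(0,2),(0,3),(1,4)], [(2,4),(3,5)], [⟨4, 4, 1, 2, wn [4,2,3,5] [], wn [] [2,4,3,5]⟩]⟩,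
  ⟨-5, 2, [(0,1),(0,2),(0,3),(1,5)], [(2,3),(2,4)], [⟨4, 4, 1, 3, wn [5,3,2,4] [], wn [] [3,5,2,4]⟩,
    ⟨5, 5, 1, 3, gr 212 [5,3] [] [1,3,0,2,4], go 113 [] [3] [0,3,1,2,5,4]⟩]⟩,
  ⟨-5, 2, [(0,1),(0,2),(0,3)], [(1,5),(2,3),(2,4)], [⟨4, 4, 0, 4, go 176 [] [5] [0,5,2,3,4], wn [4,2,3] [5]⟩]⟩,
  ⟨-3, 2, [(0,1),(0,2),(0,3),(1,4)], [(2,5)], [⟨4, 4, 1, 3, wn [4,3,2,5] [], wn [] [3,4,2,5]⟩]⟩,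
  ⟨-3, 2, [(0,1),(0,2),(0,3),(2,4)], [(0,5)], [⟨5, 7, 3, 6, gr 167 [5] [] [1,5,0,2,3,4,6], go 1 [5] [4,3,6] [5,6]⟩,
    ⟨8, 24, 3, 5, go 3 [5,2] [4,3] [2,3,0], go 10 [] [4,3,5] [0,5,2]⟩]⟩,
  ⟨-3, 2, [(0,1),(0,2),(0,3),(2,4)], [(1,5)], [⟨4, 4, 4, 5, go 123 [] [5] [0,5,2,4,3], go 2 [] [5,4] [0,4,2]⟩,
    ⟨5, 5, 2, 5, go 2 [] [5,3,4] [0,4,2], go 179 [] [5] [0,5,2,3,4]⟩]⟩,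
  ⟨-3, 2, [(0,1),(0,2),(1,3),(2,4)], [(0,4)], [⟨3, 3, 0, 3, wn [4,3,2] [], wn [3,2] [4]⟩]⟩,
  ⟨-3, 3, [(0,3),(2,3),(2,4)], [(3,5),(4,6)], [⟨4, 4, 1, 3, st 106 7, wn [4,6] [3,5]⟩,
    ⟨5, 5, 1, 3, st 106 7, go 1 [4,6] [3,5] [6,5]⟩,
    ⟨6, 7, 1, 4, go 1 [4,6] [3,5] [6,5], go 89 [] [4,6] [0,6,3,5]⟩]⟩,
  ⟨-4, 3, [(0,2),(0,3),(0,4),(1,2),(2,6)], [(0,5)], [⟨5, 5, 3, 7, wn [5] [3,6,4,7], wn [5] [4,6,3,7]⟩]⟩]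

def fams13 : List Fam := [
  ⟨-4, 3, [(0,2),(0,3),(0,4),(1,2),(1,5),(2,6)], [], [⟨5, 5, 3, 7, wn [5,6,3] [4,7], wn [5,6,3,7] [4]⟩]⟩,
  ⟨-4, 3, [(0,2),(0,3),(0,4),(1,2),(2,5)], [(5,6)], [⟨4, 4, 3, 6, wn [] [3,5,6,4], wn [] [3,6,5,4]⟩,
    ⟨5, 5, 0, 6, go 117 [] [3] [0,3,2,4,5,6], go 3 [6,5,3] [4] [3,4,0]⟩]⟩,
  ⟨-4, 3, [(0,3),(1,4),(2,3),(2,4),(3,6)], [(0,5)], [⟨5, 5, 3, 7, gr 115 [5] [] [1,5,2,4,3,6,7], gr 116 [5] [] [1,5,2,4,3,6,7]⟩]⟩,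
  ⟨-4, 3, [(0,3),(1,4),(2,3),(2,4),(3,5)], [(4,6)], [⟨4, 4, 0, 6, wn [4,6,5] [3], wn [6,4,5] [3]⟩]⟩,
  ⟨-4, 3, [(0,2),(0,3),(1,2),(4,5),(4,6)], [(0,4)], [⟨6, 6, 4, 7, go 14 [4] [3] [4,3,5,6,7], go 84 [4] [3] [4,3,5,6,7]⟩]⟩,
  ⟨-5, 3, [(0,3),(0,5),(1,3),(2,3),(2,4)], [(3,5),(4,6)], [⟨5, 5, 3, 7, go 206 [] [4] [0,4,2,3,7,5,6], wn [4,6] [5,3,7]⟩]⟩,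
  ⟨-5, 3, [(0,2),(0,3),(0,5),(1,3),(2,4)], [(0,6),(4,5)], [⟨5, 5, 3, 6, go 213 [6] [] [6,1,2,0,3,5,4], gr 283 [6,3] [] [1,3,0,2,4,5]⟩]⟩,
  ⟨-5, 3, [(0,2),(0,3),(0,5),(1,3),(2,4)], [(3,6),(4,5)], [⟨6, 6, 0, 7, go 225 [] [5] [0,5,2,3,7,4,6], go 1 [7] [5,4,3,6] [7,6]⟩]⟩,
  ⟨-5, 3, [(0,2),(0,3),(0,5),(1,3),(2,4)], [(4,5),(5,6)], [⟨4, 4, 0, 6, wn [] [6,5,4,3], wn [6,5,4,3] []⟩]⟩,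
  ⟨-5, 3, [(0,2),(0,3),(1,3),(1,5),(2,4)], [(0,6),(4,5)], [⟨4, 4, 3, 6, wn [6,5,4,3] [], wn [5,4,3,6] []⟩]⟩,
  ⟨-5, 3, [(0,2),(0,3),(1,3),(2,4),(2,5)], [(4,5),(4,6)], [⟨5, 5, 0, 6, go 287 [] [] [0,1,2,3,6,5,4], go 224 [6,4] [] [4,1,2,0,5,3]⟩]⟩,
  ⟨-5, 3, [(0,3),(0,5),(1,2),(2,3),(3,4)], [(1,6),(3,5)], [⟨4, 4, 0, 6, wn [] [6,4,5,3], wn [6] [4,5,3]⟩]⟩,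
  ⟨-4, 3, [(0,3),(2,3),(2,4),(2,5)], [(3,4),(3,6)], [⟨6, 6, 5, 7, go 221 [5] [] [5,1,2,7,3,4,6], go 124 [4,3] [] [3,1,2,5,6,7]⟩]⟩,
  ⟨-5, 3, [(0,1),(0,3),(2,3),(2,4),(2,6)], [(1,3),(3,5)], [⟨4, 4, 4, 5, wn [4] [3,5,6], wn [6] [3,5,4]⟩]⟩,
  ⟨-4, 3, [(0,3),(0,5),(2,3),(2,4),(3,4)], [(3,6)], [⟨4, 4, 1, 5, wn [4,5] [3,6], gr 160 [] [5,4] [4,0,2,3,6]⟩]⟩]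

def fams14 : List Fam := [
  ⟨-5, 3, [(0,1),(0,3),(2,3),(2,4),(4,5)], [(1,5),(3,6)], [⟨5, 5, 4, 7, gr 198 [] [5] [5,0,2,4,3,7,6], wn [4,7] [5,3,6]⟩]⟩,
  ⟨-5, 3, [(0,3),(0,4),(1,2),(2,3)], [(1,6),(3,4),(3,5)], [⟨4, 4, 0, 5, go 176 [] [6] [0,6,3,4,5], wn [5,3,4] [6]⟩]⟩,
  ⟨-4, 3, [(0,1),(0,2),(1,2),(2,3)], [(1,3),(3,4)], [⟨3, 3, 1, 5, wn [5] [3,4], wn [3,4] [5]⟩]⟩,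
  ⟨-4, 4, [(0,4),(1,4),(2,3),(2,6),(3,4),(3,5)], [(5,6)], [⟨4, 4, 0, 7, wn [5,6,4] [7], wn [7] [5,6,4]⟩]⟩,
  ⟨-5, 3, [(0,1),(0,2),(0,3),(0,6),(1,5),(2,4)], [(3,5)], [⟨5, 5, 3, 7, wn [] [4,3,5,6,7], wn [] [4,6,5,3,7]⟩]⟩,
  ⟨-5, 3, [(0,1),(0,2),(0,3),(2,4)], [(3,5),(4,6)], [⟨4, 4, 1, 6, wn [] [4,6,3,5], wn [] [6,4,3,5]⟩]⟩,
  ⟨-4, 3, [(0,3),(2,3),(2,4),(4,5)], [(1,4),(4,6)], [⟨4, 4, 5, 6, gr 226 [] [4] [4,0,2,3,5,6], wn [4,6,5,3] []⟩]⟩,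
  ⟨-4, 3, [(0,2),(0,3),(0,4),(2,5)], [(3,6)], [⟨4, 4, 1, 3, wn [] [4,5,3,6], go 77 [] [3] [0,3,2,4,5,6]⟩]⟩,
  ⟨-5, 3, [(0,1),(0,2),(0,3),(0,5),(1,6),(2,4)], [(4,5)], [⟨6, 6, 5, 7, go 68 [] [4,5] [0,5,1,3,6,7], go 114 [] [4,3] [0,3,1,5,6,7]⟩]⟩,
  ⟨-5, 3, [(0,1),(0,2),(0,3),(0,5),(2,4)], [(3,6),(4,5)], [⟨4, 4, 1, 6, wn [] [4,5,6,3], wn [] [6,3,4,5]⟩]⟩,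
  ⟨-5, 3, [(0,1),(0,2),(0,3),(0,5),(2,4)], [(4,5),(5,6)], [⟨5, 5, 3, 7, go 203 [] [7] [0,7,2,3,4,5,6], go 87 [] [4,5] [0,5,3,7,6]⟩]⟩,
  ⟨-4, 3, [(0,2),(0,3),(2,4),(2,5)], [(4,5),(4,6)], [⟨5, 5, 1, 3, st 205 7, go 1 [] [3,5,4,6] [0,6]⟩]⟩,
  ⟨-3, 3, [(0,3),(1,2),(2,3),(2,5),(3,4),(5,6)], [], [⟨5, 5, 0, 7, wn [5,4,7] [6,3], gr 167 [7] [] [1,7,2,3,5,4,6]⟩]⟩,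
  ⟨-3, 3, [(0,1),(1,2),(1,3),(2,5),(3,4)], [(1,6)], [⟨5, 5, 4, 6, go 2 [5,3] [6] [3,6,4], go 1 [5,3] [6,4] [3,4]⟩]⟩,
  ⟨-2, 4, [(0,2),(1,5),(2,3),(2,4),(3,5)], [(0,4)], [⟨3, 3, 1, 4, gr 284 [] [] [1,0,2,3,4,5], st 285 6⟩]⟩]

def fams15 : List Fam := [
  ⟨-5, 3, [(0,1),(0,2),(0,3),(0,4),(2,5)], [(1,5),(3,6)], [⟨5, 5, 1, 7, wn [] [5,4,7,3,6], go 217 [] [7] [0,7,2,3,4,5,6]⟩]⟩,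
  ⟨-3, 3, [(0,2),(0,4),(1,3),(2,3),(4,5)], [(0,5)], [⟨3, 3, 1, 4, wn [5,3,4] [], wn [5] [4,3]⟩]⟩,
  ⟨-2, 2, [(0,1),(0,2)], [(0,3),(2,4)], [⟨4, 4, 2, 3, st 232 5, go 3 [3,2] [] [2,1,0]⟩]⟩,
  ⟨-3, 2, [(0,2),(0,3),(0,4),(1,2)], [(2,3)], [⟨3, 3, 2, 4, wn [] [4,3,2], wn [] [3,2,4]⟩]⟩,
  ⟨-3, 2, [(0,2),(1,2),(1,3)], [(0,3),(1,4)], [⟨4, 6, 2, 4, gr 178 [3] [] [1,3,2,4], go 1 [3] [4,2] [3,2]⟩,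
    ⟨7, 24, 3, 4, go 3 [3] [4,2] [3,2,1], gr 10 [3,4] [] [1,4,2]⟩]⟩,
  ⟨-3, 2, [(0,1),(0,2),(0,3)], [(1,4),(2,3)], [⟨3, 3, 2, 4, wn [] [4,3,2], wn [] [4,2,3]⟩]⟩,
  ⟨-3, 2, [(0,1),(0,2),(2,3)], [(0,3),(1,4)], [⟨3, 3, 2, 4, go 2 [3] [4] [3,4,2], wn [3] [4,2]⟩]⟩,
  ⟨-3, 2, [(0,1),(0,2),(2,3)], [(0,3),(2,4)], [⟨4, 4, 3, 4, st 293 5, go 1 [3,4,2] [] [2,1]⟩,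
    ⟨5, 5, 0, 4, go 3 [3,4,2] [] [2,1,0], go 4 [4,2] [3] [2,3]⟩]⟩,
  ⟨-4, 2, [(2,3),(2,4),(2,5),(3,6)], [(0,4)], [⟨4, 4, 1, 6, wn [4,6,5] [2], go 2 [4] [6,5] [4,5,2]⟩]⟩,
  ⟨-5, 2, [(0,2),(2,3),(2,4),(3,5),(3,6)], [(5,7)], [⟨5, 5, 0, 7, wn [6,4,5,7,3] [], go 233 [7] [] [7,1,3,2,5,6,4]⟩,
    ⟨6, 6, 1, 4, gr 49 [] [3] [3,0,2,4,5,6,7], gr 127 [5,7] [] [1,7,2,3,4,6]⟩]⟩,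
  ⟨-5, 2, [(0,2),(0,3),(0,4),(2,5),(3,6)], [(2,7)], [⟨6, 6, 1, 3, go 75 [] [] [0,1,3,2,4,6,5,7], wn [] [3,5,4,6,2,7]⟩]⟩,
  ⟨-6, 2, [(0,2),(0,5),(1,3),(2,3),(2,4),(5,6)], [(0,6)], [⟨6, 6, 1, 7, wn [6,2,7] [4,5,3], go 115 [6] [7] [6,7,0,5,2,3,4]⟩]⟩,
  ⟨-5, 2, [(0,2),(1,6),(2,3),(2,4),(3,5)], [(3,6)], [⟨5, 5, 1, 4, wn [5,4] [3,6,2], go 28 [] [4] [0,4,3,2,5,6]⟩]⟩,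
  ⟨-6, 2, [(0,2),(1,2),(2,3),(2,4),(3,5)], [(0,7),(3,6)], [⟨6, 6, 6, 7, gr 237 [7] [] [1,7,2,3,4,5,6], go 2 [7,6,3] [5,4] [3,4,2]⟩]⟩,
  ⟨-6, 2, [(0,2),(0,5),(1,2),(2,3),(2,4)], [(1,7),(2,6)], [⟨6, 6, 3, 7, go 33 [] [7] [0,7,2,3,4,5,6], go 267 [] [7,3] [0,3,2,4,5,6]⟩]⟩]

def fams16 : List Fam := [
  ⟨-6, 2, [(0,2),(0,5),(1,2),(2,3),(2,4),(5,6)], [(1,6)], [⟨6, 6, 3, 7, wn [7,4,5,3] [6,2], go 152 [] [6] [0,6,2,3,4,5,7]⟩]⟩,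
  ⟨-6, 2, [(0,2),(0,5),(1,2),(2,3),(2,4)], [(1,6),(5,6)], [⟨6, 6, 0, 7, go 2 [] [6,5,3,7,4] [0,4,2], go 268 [7] [6] [7,6,0,2,3,4,5]⟩]⟩,
  ⟨-6, 2, [(0,2),(0,4),(0,5),(1,2),(2,3)], [(1,6),(2,6)], [⟨6, 6, 4, 7, wn [] [4,3,5,7,2,6], go 189 [] [6,2] [0,2,4,5,3,7]⟩]⟩,
  ⟨-6, 2, [(0,2),(0,5),(1,2),(2,3),(3,4)], [(0,7),(2,6)], [⟨7, 7, 2, 7, gr 138 [] [5,3] [3,0,2,7,4,6], gr 223 [7,2] [] [1,2,0,3,4,5,6]⟩]⟩,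
  ⟨-6, 2, [(0,2),(0,4),(0,5),(1,2),(2,3),(2,6)], [(1,6)], [⟨6, 6, 4, 7, wn [] [6,4,3,5,7,2], go 49 [] [6] [0,6,2,3,4,5,7]⟩]⟩,
  ⟨-6, 2, [(0,2),(0,4),(0,6),(1,2),(2,3),(4,5)], [(3,6)], [⟨6, 6, 4, 7, wn [] [4,3,6,5,2,7], go 73 [] [6,3] [0,3,4,5,2,7]⟩]⟩,
  ⟨-6, 2, [(0,2),(0,4),(1,2),(2,3),(5,6)], [(0,5),(3,6)], [⟨7, 7, 1, 6, gr 286 [5] [] [1,5,0,2,3,4,6], go 271 [] [6] [0,6,2,4,3,5]⟩]⟩,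
  ⟨-6, 2, [(0,1),(0,2),(0,6),(2,3),(2,4),(2,5)], [(2,7)], [⟨7, 7, 3, 8, go 63 [] [3] [0,3,2,4,5,6,8,7], go 239 [] [3] [0,3,2,4,5,6,7,8]⟩]⟩,
  ⟨-6, 2, [(0,1),(0,2),(0,5),(0,6),(2,3),(2,4),(5,7)], [], [⟨7, 7, 1, 8, wn [] [3,5,4,6,7,2,8], go 42 [] [8] [0,8,2,5,6,3,4,7]⟩,
    ⟨8, 8, 3, 8, go 69 [] [3] [0,3,2,4,5,6,8,7], go 76 [] [4] [0,4,2,3,5,6,7,8]⟩,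
    ⟨9, 9, 2, 8, go 59 [] [3] [0,3,2,4,8,5,6,7], go 52 [] [7,6] [0,6,2,3,4,5,8]⟩]⟩,
  ⟨-6, 2, [(0,1),(0,2),(0,5),(2,3),(2,4)], [(2,6),(2,7)], [⟨7, 7, 3, 6, go 194 [6,2] [] [2,1,0,3,4,7,5], go 1 [] [4,5,3,6,2,7] [0,7]⟩]⟩,
  ⟨-6, 2, [(0,1),(0,2),(0,5),(2,3),(2,4),(5,6)], [(0,6)], [⟨6, 6, 3, 7, wn [6,2] [3,5,4,7], wn [6,2] [4,5,3,7]⟩]⟩,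
  ⟨-6, 2, [(0,1),(0,2),(0,5),(1,7),(2,3),(2,4)], [(0,6)], [⟨8, 8, 3, 6, go 163 [6] [] [6,1,0,2,3,4,5,7], go 4 [6,3,5,7,2] [4] [2,4]⟩]⟩,
  ⟨-6, 2, [(0,1),(0,2),(0,5),(1,7),(2,3),(2,4),(3,6)], [], [⟨7, 7, 3, 8, wn [6,4,8] [3,5,7,2], wn [6,4,5,7,2] [3,8]⟩]⟩,
  ⟨-6, 2, [(0,1),(0,2),(0,5),(1,7),(2,3),(2,4)], [(3,6)], [⟨7, 7, 6, 7, go 108 [6,3] [] [3,1,0,2,4,5,7], go 2 [] [3,6,7,5,4] [0,4,2]⟩]⟩,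
  ⟨-6, 2, [(0,1),(0,2),(0,3),(0,4),(1,6),(2,5)], [(1,7)], [⟨6, 6, 2, 7, wn [] [7,3,5,4,6,2], wn [] [7,2,6,3,5,4]⟩]⟩]

def fams17 : List Fam := [
  ⟨-6, 2, [(0,1),(0,2),(0,3),(0,4),(2,5),(3,6)], [(2,7)], [⟨7, 7, 1, 8, wn [] [5,3,8,4,6,2,7], go 235 [] [8] [0,8,2,3,4,5,6,7]⟩,
    ⟨8, 8, 1, 7, go 218 [] [5,3] [0,3,1,4,7,2,6], go 4 [] [7,2,6,4,5,3] [0,3]⟩,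
    ⟨9, 9, 0, 7, go 146 [] [5,7] [0,7,3,6,4,2], go 3 [7,2,6,4,5,3] [] [3,1,0]⟩]⟩,
  ⟨-6, 2, [(0,1),(0,2),(0,3),(0,4),(2,5)], [(1,6),(2,6)], [⟨6, 6, 3, 7, wn [] [6,2,7,4,5,3], go 189 [] [6,2] [0,2,3,4,5,7]⟩]⟩,
  ⟨-6, 2, [(0,1),(0,2),(0,3),(0,4),(0,6),(2,5)], [(1,6)], [⟨7, 7, 6, 7, go 57 [] [6] [0,6,2,3,4,5,7], go 61 [] [6] [0,6,2,3,4,5,7]⟩]⟩,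
  ⟨-6, 2, [(0,1),(0,2),(0,3),(0,4),(2,5),(2,6)], [(1,6)], [⟨6, 6, 3, 7, wn [] [6,3,5,4,7,2], go 49 [] [6] [0,6,2,5,3,4,7]⟩]⟩,
  ⟨-6, 2, [(0,1),(0,2),(0,3),(0,4),(2,5)], [(3,6),(3,7)], [⟨7, 7, 1, 6, go 220 [] [5,4] [0,4,1,2,6,3,7], go 191 [] [6,3] [0,3,2,4,5,7]⟩]⟩,
  ⟨-6, 2, [(0,1),(0,2),(0,3),(1,5),(2,4),(6,7)], [(0,6)], [⟨9, 9, 6, 8, go 199 [] [4,3,5] [0,5,1,2,6,7,8], gr 74 [6,8] [] [1,8,0,2,3,4,5]⟩]⟩,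
  ⟨-5, 3, [(0,3),(0,7),(1,6),(2,3),(2,6),(3,4),(3,5)], [], [⟨6, 6, 4, 8, wn [6,4,7,5,8] [3], wn [6,5,7,4,8] [3]⟩]⟩,
  ⟨-6, 3, [(0,1),(0,3),(2,3),(2,5),(2,6),(3,4)], [(5,7),(6,7)], [⟨5, 5, 0, 8, wn [5,7,6,4,8] [], wn [8] [4,5,7,6]⟩]⟩,
  ⟨-4, 2, [(0,2),(2,3),(2,4)], [(0,5),(3,5)], [⟨5, 5, 4, 6, go 127 [5] [] [5,1,2,4,3,6], go 172 [5] [] [5,1,2,3,4,6]⟩]⟩,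
  ⟨-4, 2, [(0,2),(0,5),(2,3),(2,4)], [(3,5)], [⟨5, 5, 1, 5, go 157 [] [] [0,1,5,2,4,3], go 291 [] [5] [0,5,2,4,3]⟩]⟩,
  ⟨-4, 2, [(0,2),(2,3),(3,4)], [(1,5),(4,5)], [⟨5, 5, 0, 3, go 2 [] [5,4,2] [0,2,3], go 4 [3] [5,4] [3,4]⟩]⟩,
  ⟨-5, 2, [(0,2),(0,3),(0,4),(2,5)], [(2,3),(3,4)], [⟨4, 4, 1, 4, wn [] [2,3,4,5], wn [] [4,5,3,2]⟩]⟩,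
  ⟨-3, 2, [(0,2),(0,4),(1,2),(2,3)], [(2,5)], [⟨4, 4, 0, 5, wn [] [4,3,5,2], wn [5,2] [4,3]⟩]⟩,
  ⟨-3, 3, [(2,3),(2,6),(3,4),(3,5)], [(1,6)], [⟨4, 4, 0, 4, go 2 [5] [6,4] [5,4,3], go 2 [4] [6,5] [4,5,3]⟩]⟩,
  ⟨-5, 2, [(0,2),(0,4),(2,3),(3,5)], [(1,5),(2,4)], [⟨4, 4, 0, 3, wn [] [5,2,4,3], wn [3,4,2] [5]⟩]⟩]

def fams18 : List Fam := [
  ⟨-6, 2, [(0,2),(0,4),(1,3),(2,3),(4,5)], [(0,3),(1,5)], [⟨6, 6, 2, 6, go 162 [3] [] [3,1,0,2,6,4,5], go 210 [3] [] [3,1,0,2,4,5,6]⟩]⟩,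
  ⟨-5, 2, [(0,2),(0,3),(1,5),(2,4)], [(0,5),(1,4)], [⟨6, 6, 3, 5, go 270 [] [] [0,1,3,5,2,4], go 104 [] [4] [0,4,2,3,5]⟩]⟩,
  ⟨-6, 2, [(0,2),(1,2),(2,3),(3,4)], [(0,5),(2,4),(2,5)], [⟨5, 5, 1, 6, wn [6,3] [4,2,5], go 231 [5,2] [] [2,1,3,4,6]⟩,
    ⟨6, 7, 3, 6, go 2 [5,2,4] [6] [4,6,3], go 232 [5,2] [] [2,1,3,4,6]⟩]⟩,
  ⟨-6, 2, [(0,3),(1,3),(2,3),(2,4)], [(0,2),(2,5),(4,5)], [⟨4, 4, 0, 6, wn [2,5,4] [6], wn [6] [4,5,2]⟩]⟩,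
  ⟨-6, 2, [(0,2),(0,4),(1,2),(2,3)], [(1,5),(2,4),(4,5)], [⟨4, 4, 3, 6, wn [6] [5,4,2], wn [] [5,4,3,6]⟩]⟩,
  ⟨-6, 2, [(0,1),(0,2),(0,4),(1,5),(2,3)], [(2,4),(2,5)], [⟨5, 5, 0, 6, wn [] [3,4,2,5,6], wn [6] [3,4,2,5]⟩]⟩,
  ⟨-6, 2, [(0,1),(0,2),(0,4),(2,3),(3,5)], [(2,4),(2,5)], [⟨6, 6, 3, 6, gr 279 [] [3] [3,0,2,5,6,4], go 125 [5,2] [] [2,1,0,3,4,6]⟩]⟩,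
  ⟨-4, 3, [(0,1),(1,2),(2,3),(2,5),(3,4)], [(5,6)], [⟨5, 5, 3, 7, go 196 [3] [] [3,1,2,4,7,5,6], wn [3,7] [4,5,6]⟩]⟩,
  ⟨-4, 3, [(0,2),(0,3),(0,5),(2,6),(3,4)], [(5,6)], [⟨4, 4, 1, 5, wn [] [3,6,5,4], go 93 [] [5,6] [0,6,2,3,4]⟩,
    ⟨5, 5, 1, 3, go 165 [] [] [0,1,2,3,4,6,5], go 3 [] [3,6,5,4] [0,4,3]⟩]⟩,
  ⟨-6, 2, [(0,2),(0,3),(0,4),(1,2),(1,5)], [(2,3),(2,5)], [⟨5, 5, 3, 6, wn [5,2,3] [4,6], wn [5,2,3,6] [4]⟩]⟩,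
  ⟨-6, 2, [(0,2),(0,3),(1,2),(1,4)], [(0,5),(2,4),(3,5)], [⟨5, 5, 2, 6, wn [5,3,6,4,2] [], wn [4,2,6] [3,5]⟩]⟩,
  ⟨-4, 3, [(1,3),(2,3),(2,4),(4,5),(4,6)], [(3,6)], [⟨4, 4, 0, 5, wn [6,3,5] [4], wn [5,3,6] [4]⟩,
    ⟨6, 7, 0, 5, st 282 7, go 4 [5,3,6] [4] [6,4]⟩]⟩,
  ⟨-5, 3, [(0,5),(1,3),(2,3),(2,4),(4,5),(4,6)], [(3,6)], [⟨6, 6, 4, 7, gr 169 [] [4] [4,0,2,5,7,3,6], gr 201 [] [4] [4,0,2,5,3,6,7]⟩,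
    ⟨7, 7, 5, 7, gr 165 [] [4] [4,0,2,5,7,3,6], gr 202 [] [4] [4,0,2,5,3,6,7]⟩]⟩,
  ⟨-2, 4, [(0,1),(1,2),(2,3),(2,5),(3,4)], [(4,5)], [⟨3, 3, 1, 6, wn [5,6] [4], wn [5,4] [6]⟩]⟩,
  ⟨-3, 4, [(0,4),(0,5),(1,2),(2,3),(2,4),(3,5)], [(1,4)], [⟨3, 3, 4, 6, wn [] [4,5,6], wn [] [5,4,6]⟩]⟩]

def fams19 : List Fam := [
  ⟨-3, 4, [(0,2),(1,5),(2,3),(2,4),(3,5)], [(0,4),(1,4)], [⟨3, 3, 0, 6, wn [5] [4,6], wn [6] [4,5]⟩]⟩,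
  ⟨-5, 3, [(0,3),(0,6),(1,6),(2,3),(2,5),(3,4)], [(4,6)], [⟨6, 6, 3, 7, gr 214 [] [3] [3,0,2,4,5,6,7], gr 126 [5,4] [] [1,4,0,6,3,7]⟩]⟩,
  ⟨-6, 3, [(0,2),(0,3),(0,4),(1,3),(2,5),(2,6)], [(4,6),(5,6)], [⟨5, 5, 5, 7, wn [7] [4,6,5,3], wn [] [4,6,3,5,7]⟩]⟩,
  ⟨-3, 2, [(0,1),(0,2),(0,3),(1,2)], [(1,4)], [⟨3, 3, 0, 4, wn [] [4,2,3], wn [4] [3,2]⟩]⟩,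
  ⟨-3, 2, [(0,1),(0,2),(0,3),(3,4)], [(2,4)], [⟨3, 3, 2, 3, wn [4,2] [3], wn [] [4,2,3]⟩,
    ⟨4, 4, 1, 2, go 292 [] [] [0,1,3,2,4], go 2 [] [2,4] [0,4,3]⟩,
    ⟨5, 24, 0, 5, go 90 [] [4,2] [0,2,3,5], gr 229 [] [4] [4,0,3,2,5]⟩]⟩,
  ⟨-3, 2, [(0,1),(0,2),(0,3)], [(2,4),(3,4)], [⟨3, 24, 1, 2, go 3 [] [3,4,2] [0,2,1], go 1 [] [2,4,3] [0,3]⟩]⟩,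
  ⟨-3, 2, [(0,1),(0,2),(2,3),(2,4)], [(1,4)], [⟨4, 4, 0, 3, go 294 [] [] [0,1,3,2,4], go 2 [3] [4] [3,4,2]⟩]⟩,
  ⟨-4, 2, [(0,1),(0,2),(0,3),(1,3),(2,4)], [(3,4)], [⟨4, 4, 0, 5, wn [] [2,3,4,5], wn [5] [2,3,4]⟩]⟩,
  ⟨-4, 2, [(0,1),(0,2),(2,3),(3,4)], [(0,3),(2,4)], [⟨4, 4, 2, 5, wn [3] [5,4,2], wn [4,2,5] [3]⟩]⟩,
  ⟨-4, 2, [(0,1),(0,2),(0,3),(2,3),(3,4)], [(1,4)], [⟨4, 4, 2, 5, wn [5,3] [4,2], wn [4,2,5] [3]⟩]⟩]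

def fams : List Fam :=
  fams0 ++
  fams1 ++
  fams2 ++
  fams3 ++
  fams4 ++
  fams5 ++
  fams6 ++
  fams7 ++
  fams8 ++
  fams9 ++
  fams10 ++
  fams11 ++
  fams12 ++
  fams13 ++
  fams14 ++
  fams15 ++
  fams16 ++
  fams17 ++
  fams18 ++
  fams19

theorem fams_ok : allOk fams fams = true := by decide +kernel

theorem builder_wins {n : ℕ} (hn : 8 ≤ n) : W n (2 * n - 2) [] := by
  have key : ∀ k, 8 ≤ k → k ≤ 24 → covers startFam k = true := by
    intro k h1 h2
    simp [covers, startFam, h1, h2]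
  have hmem : startFam ∈ fams := List.mem_of_getElem? (i := 0) rfl
  exact builder_wins_of fams_ok hmem rfl rfl rfl rfl (key _ (by omega) (by omega)) hn

/-! ### The lower bound: Painter keeps the red graph acyclic -/

open Classical in
/-- Painter colours an edge red exactly when it joins two red components. -/
noncomputable def forestPainter : PainterStrat := fun h e =>
  decide (∀ u v, e = s(u, v) → ¬ (redGraph h).Reachable u v)

theorem redGraph_adj {h : History} {u v : ℕ} :
    (redGraph h).Adj u v ↔ (s(u, v), true) ∈ h ∧ u ≠ v := by
  simp [redGraph, redSet]

theorem redGraph_mono {h k : History} (hk : h ⊆ k) : redGraph h ≤ redGraph k := by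
  intro u v huv
  rw [redGraph_adj] at huv ⊢
  exact ⟨hk huv.1, huv.2⟩

theorem forest_invariant (B : BuilderStrat) (t : ℕ) :
    (redGraph (gamePlay B forestPainter t)).IsAcyclic ∧
    ∀ u v, (s(u, v), false) ∈ gamePlay B forestPainter t →
      (redGraph (gamePlay B forestPainter t)).Reachable u v := by
  induction t with
  | zero =>
    refine ⟨?_, by simp [gamePlay]⟩
    refine SimpleGraph.isAcyclic_bot.anti ?_
    intro u v huv
    rw [redGraph_adj] at huv
    simp [gamePlay] at huv
  | succ t ih =>
    obtain ⟨hac, hbl⟩ := ih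
    have hsucc : gamePlay B forestPainter (t + 1) = gamePlay B forestPainter t ++
      [(B (gamePlay B forestPainter t),
        forestPainter (gamePlay B forestPainter t) (B (gamePlay B forestPainter t)))] := rfl
    rw [hsucc]
    generalize gamePlay B forestPainter t = h at *
    generalize B h = e at *
    have hmono : redGraph h ≤ redGraph (h ++ [(e, forestPainter h e)]) :=
      redGraph_mono (List.subset_append_left _ _)
    obtain ⟨x, y, rfl⟩ : ∃ x y, e = s(x, y) := Sym2.ind (fun x y => ⟨x, y, rfl⟩) e
    by_cases hxy : (redGraph h).Reachable x y
    · have hp : forestPainter h s(x, y) = false := by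
        simp only [forestPainter, decide_eq_false_iff_not]
        intro hall
        exact hall x y rfl hxy
      rw [hp] at hmono ⊢
      refine ⟨hac.anti ?_, ?_⟩
      · intro u v huv
        rw [redGraph_adj] at huv ⊢
        simpa using huv
      · intro u v huv
        rw [List.mem_append] at huv
        rcases huv with huv | huv
        · exact (hbl u v huv).mono hmono
        · simp only [List.mem_singleton, Prod.mk.injEq, and_true, Sym2.eq_iff] at huv
          rcases huv with ⟨rfl, rfl⟩ | ⟨rfl, rfl⟩
          · exact hxy.mono hmono
          · exact hxy.symm.mono hmono
    · have hp : forestPainter h s(x, y) = true := by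
        simp only [forestPainter, decide_eq_true_eq]
        intro u v huv
        rw [Sym2.eq_iff] at huv
        rcases huv with ⟨rfl, rfl⟩ | ⟨rfl, rfl⟩
        · exact hxy
        · exact fun hr => hxy hr.symm
      rw [hp] at hmono ⊢
      refine ⟨(hac.sup_edge_of_not_reachable hxy).anti ?_, ?_⟩
      · intro u v huv
        rw [redGraph_adj, List.mem_append] at huv
        rw [SimpleGraph.sup_adj, redGraph_adj, SimpleGraph.edge_adj]
        rcases huv with ⟨huv | huv, hne⟩
        · exact Or.inl ⟨huv, hne⟩
        · simp only [List.mem_singleton, Prod.mk.injEq, and_true, Sym2.eq_iff] at huv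
          exact Or.inr ⟨by tauto, hne⟩
      · intro u v huv
        rw [List.mem_append] at huv
        rcases huv with huv | huv
        · exact (hbl u v huv).mono hmono
        · simp at huv

/-- Every vertex reachable from, and different from, a root has a neighbour closer to the root. -/
theorem exists_closer {G : SimpleGraph ℕ} {a r : ℕ} (hr : G.Reachable a r) (hne : a ≠ r) :
    ∃ w, G.Adj a w ∧ G.dist w r < G.dist a r := by
  obtain ⟨p, hp⟩ := hr.exists_walk_length_eq_dist
  cases p with
  | nil => exact absurd rfl hne
  | cons hadj q =>
    refine ⟨_, hadj, ?_⟩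
    have := SimpleGraph.dist_le q
    simp only [SimpleGraph.Walk.length_cons] at hp
    omega

theorem blue_path_long {h : History} {m : ℕ}
    (hbl : ∀ u v, (s(u, v), false) ∈ h → (redGraph h).Reachable u v)
    (hc : HasCopy (SimpleGraph.pathGraph (m + 1)) (blueGraph h)) : 2 * m ≤ h.length := by
  obtain ⟨f, hf⟩ := hc
  have hblue : ∀ i : Fin m, (s(f i.castSucc, f i.succ), false) ∈ h := by
    intro i
    have h1 : (SimpleGraph.pathGraph (m + 1)).Adj i.castSucc i.succ := by
      rw [SimpleGraph.pathGraph_adj]; left; simp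
    have h2 := f.map_rel h1
    simp only [blueGraph, blueSet, SimpleGraph.fromEdgeSet_adj, Set.mem_ofPred_eq] at h2
    exact h2.1
  have hreach : ∀ i : Fin (m + 1), (redGraph h).Reachable (f i) (f 0) := by
    intro i
    induction i using Fin.induction with
    | zero => exact SimpleGraph.Reachable.refl _
    | succ i ih => exact (hbl _ _ (hblue i)).symm.trans ih
  have hcl : ∀ i : Fin m, ∃ w, (redGraph h).Adj (f i.succ) w ∧
      (redGraph h).dist w (f 0) < (redGraph h).dist (f i.succ) (f 0) := by
    intro i
    refine exists_closer (hreach _) ?_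
    intro he
    exact Fin.succ_ne_zero i (hf he)
  choose w hw1 hw2 using hcl
  let g : Fin m ⊕ Fin m → Edge × Bool :=
    Sum.elim (fun i => (s(f i.castSucc, f i.succ), false)) (fun i => (s(f i.succ, w i), true))
  have hg : Function.Injective g := by
    rintro (i | i) (j | j) hij
    · simp only [g, Sum.elim_inl, Prod.mk.injEq, and_true, Sym2.eq_iff, hf.eq_iff] at hij
      congr 1
      rcases hij with ⟨-, h2⟩ | ⟨h1, h2⟩
      · exact Fin.succ_injective _ h2
      · simp only [Fin.ext_iff, Fin.val_castSucc, Fin.val_succ] at h1 h2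
        omega
    · simp [g] at hij
    · simp [g] at hij
    · simp only [g, Sum.elim_inr, Prod.mk.injEq, and_true, Sym2.eq_iff, hf.eq_iff] at hij
      congr 1
      rcases hij with ⟨h1, -⟩ | ⟨h1, h2⟩
      · exact Fin.succ_injective _ h1
      · have e1 := hw2 i
        have e2 := hw2 j
        rw [h2] at e1
        rw [← h1] at e2
        omega
  have hsub : Finset.univ.image g ⊆ h.toFinset := by
    intro e he
    obtain ⟨i, -, rfl⟩ := Finset.mem_image.1 he
    rw [List.mem_toFinset]
    rcases i with i | i
    · exact hblue i
    · exact (redGraph_adj.1 (hw1 i)).1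
  have hcard := Finset.card_le_card hsub
  rw [Finset.card_image_of_injective _ hg] at hcard
  have hlen := h.toFinset_card_le
  simp at hcard
  omega

theorem painter_avoids (B : BuilderStrat) {n : ℕ} (hn : 8 ≤ n) :
    ¬ HasCopy (SimpleGraph.cycleGraph 4) (redGraph (gamePlay B forestPainter (2 * n - 3))) ∧
    ¬ HasCopy (SimpleGraph.pathGraph n) (blueGraph (gamePlay B forestPainter (2 * n - 3))) := by
  obtain ⟨hac, hbl⟩ := forest_invariant B (2 * n - 3)
  constructor
  · rintro ⟨f, hf⟩
    exact SimpleGraph.isAcyclic_iff_free_cycleGraph.1 hac 4 (by norm_num) ⟨⟨f, hf⟩⟩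
  · intro hc
    obtain ⟨m, rfl⟩ : ∃ m, n = m + 1 := ⟨n - 1, by omega⟩
    have := blue_path_long hbl hc
    rw [gamePlay_length] at this
    omega

/-- For every `n ≥ 8`, `r̃(C₄, Pₙ) = 2n - 2`: Builder can force a red `C₄` or a blue
`Pₙ` within `2n - 2` rounds, while for every Builder strategy some Painter strategy
avoids both for `2n - 3` rounds. -/
theorem onlineRamsey_C4_path_eq (n : ℕ) (hn : 8 ≤ n) :
    BuilderForces (SimpleGraph.cycleGraph 4) (SimpleGraph.pathGraph n) (2 * n - 2) ∧
    ∀ B : BuilderStrat, BuilderLegal B (2 * n - 3) →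
      ∃ P : PainterStrat,
        ¬ HasCopy (SimpleGraph.cycleGraph 4) (redGraph (gamePlay B P (2 * n - 3))) ∧
        ¬ HasCopy (SimpleGraph.pathGraph n) (blueGraph (gamePlay B P (2 * n - 3))) := by
  exact ⟨builderForces_of_W (builder_wins hn), fun B _ => ⟨forestPainter, painter_avoids B hn⟩⟩

end OnlineRamsey
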